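/- arXiv:1009.5797 — 5 statements merged into one kernel-verified Lean document; each statement's English description precedes it below -/
import Mathlib

section
/- Let p ≥ 1 and ν ≥ 1 be integers, R > 0, and ζ ∈ (0,π). Then the (absolutely convergent) series Σ_{j=0}^∞ (j+ν) I_{p(j+ν)}(R) C_j^ν(cos ζ) equals (1/(2^ν (ν−1)!)) · L^ν[ ζ ↦ (1/p) Σ_{s=1}^p exp( R cos((ζ+2πs)/p) ) ](ζ), where L^ν is applied to the indicated function of ζ and then evaluated at ζ. -/
/-- Modified Bessel function of the first kind of real order `α ≥ 0`. -/
noncomputable def besselI (α R : ℝ) : ℝ :=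
  ∑' m : ℕ, (R / 2) ^ (2 * (m : ℝ) + α) / (Nat.factorial m * Real.Gamma ((m : ℝ) + α + 1))

/-- Gegenbauer polynomial `C_j^ν(x)` for real `ν > 0`. -/
noncomputable def gegenbauerC (ν : ℝ) (j : ℕ) (x : ℝ) : ℝ :=
  ∑ k ∈ Finset.range (j / 2 + 1),
    (-1 : ℝ) ^ k * Real.Gamma (ν + (j : ℝ) - (k : ℝ)) /
      (Real.Gamma ν * Nat.factorial k * Nat.factorial (j - 2 * k)) * (2 * x) ^ (j - 2 * k)

/-- The operator `L g (ζ) = - g'(ζ) / sin ζ`. -/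
noncomputable def Lop (g : ℝ → ℝ) : ℝ → ℝ := fun ζ => -(deriv g ζ) / Real.sin ζ

open Finset

/-! ### Modified Bessel functions of integer order -/

theorem besselI_natCast (n : ℕ) (R : ℝ) :
    besselI (n : ℝ) R =
      ∑' m : ℕ, (R / 2) ^ (2 * m + n) / ((m.factorial : ℝ) * (m + n).factorial) := by
  unfold besselI
  refine tsum_congr fun m => ?_
  have h1 : (2 * (m : ℝ) + n) = ((2 * m + n : ℕ) : ℝ) := by push_cast; ring
  have h2 : ((m : ℝ) + n + 1) = ((m + n : ℕ) : ℝ) + 1 := by push_cast; ring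
  rw [h1, h2, Real.rpow_natCast, Real.Gamma_nat_eq_factorial]

theorem abs_besselI_natCast_le (n : ℕ) {R : ℝ} (hR : 0 < R) :
    |besselI (n : ℝ) R| ≤ Real.exp ((R / 2) ^ 2) * ((R / 2) ^ n / n.factorial) := by
  rw [besselI_natCast n R]
  have hs : HasSum (fun m : ℕ => ((R / 2) ^ 2) ^ m / m.factorial * ((R / 2) ^ n / n.factorial))
      (Real.exp ((R / 2) ^ 2) * ((R / 2) ^ n / n.factorial)) := by
    have h : HasSum (fun m : ℕ => ((R / 2) ^ 2) ^ m / m.factorial) (Real.exp ((R / 2) ^ 2)) := by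
      rw [congrFun Real.exp_eq_exp_ℝ]
      exact NormedSpace.expSeries_div_hasSum_exp ((R / 2) ^ 2)
    exact h.mul_right ((R / 2) ^ n / n.factorial)
  rw [← Real.norm_eq_abs]
  refine tsum_of_norm_bounded hs fun m => ?_
  rw [Real.norm_of_nonneg (by positivity), div_mul_div_comm, ← pow_mul, ← pow_add]
  have : (n.factorial : ℝ) ≤ (m + n).factorial := by
    exact_mod_cast Nat.factorial_le (Nat.le_add_left n m)
  gcongr

theorem summable_pow_mul_abs_besselI {p : ℕ} (hp : 1 ≤ p) {R : ℝ} (hR : 0 < R) {K : ℝ}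
    (hK : 1 ≤ K) : Summable fun j : ℕ => K ^ j * |besselI ((p * j : ℕ) : ℝ) R| := by
  have h := ((Real.summable_pow_div_factorial (K * (R / 2))).mul_left
    (Real.exp ((R / 2) ^ 2))).comp_injective (mul_right_injective₀ (by omega : p ≠ 0))
  refine Summable.of_nonneg_of_le (fun j => by positivity) (fun j => ?_) h
  calc K ^ j * |besselI ((p * j : ℕ) : ℝ) R|
      ≤ K ^ (p * j) * (Real.exp ((R / 2) ^ 2) * ((R / 2) ^ (p * j) / (p * j).factorial)) := by
        gcongr
        · exact Nat.le_mul_of_pos_left j hp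
        · exact abs_besselI_natCast_le _ hR
    _ = _ := by simp only [Function.comp_apply, mul_pow]; ring

theorem summable_mul_pow_mul_abs_besselI {p : ℕ} (hp : 1 ≤ p) {R : ℝ} (hR : 0 < R) {K : ℝ}
    (hK : 1 ≤ K) (n : ℕ) : Summable fun j : ℕ =>
      ((j : ℝ) + n) * |besselI ((p : ℝ) * ((j : ℝ) + n)) R| * K ^ j := by
  have h := (summable_pow_mul_abs_besselI hp hR (K := 2 * K) (by linarith)).comp_injective
    (add_left_injective n)
  refine Summable.of_nonneg_of_le (fun j => by positivity) (fun j => ?_) h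
  have h1 : ((j : ℝ) + n) ≤ 2 ^ (j + n) := by exact_mod_cast (Nat.lt_two_pow_self (n := j + n)).le
  have h2 : K ^ j ≤ K ^ (j + n) := pow_le_pow_right₀ hK (by omega)
  have h3 : (p : ℝ) * ((j : ℝ) + n) = ((p * (j + n) : ℕ) : ℝ) := by push_cast; ring
  simp only [Function.comp_apply]
  rw [h3, mul_pow]
  calc _ ≤ 2 ^ (j + n) * |besselI ((p * (j + n) : ℕ) : ℝ) R| * K ^ (j + n) := by gcongr
    _ = _ := by ring

/-- The bijection `(n, m) ↦ (m + n⁺, m + n⁻)`. -/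
def intProdNatEquiv : ℤ × ℕ ≃ ℕ × ℕ where
  toFun x := (x.2 + x.1.toNat, x.2 + (-x.1).toNat)
  invFun y := ((y.1 : ℤ) - y.2, min y.1 y.2)
  left_inv x := by
    obtain ⟨n, m⟩ := x
    ext <;> simp <;> omega
  right_inv y := by
    obtain ⟨a, b⟩ := y
    ext <;> simp <;> omega

theorem hasSum_besselI_mul_zpow (R : ℝ) {w : ℂ} (hw : w ≠ 0) :
    HasSum (fun n : ℤ => (besselI (n.natAbs : ℝ) R : ℂ) * w ^ n)
      (Complex.exp (R / 2 * (w + w⁻¹))) := by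
  have h1 := NormedSpace.expSeries_div_hasSum_exp ((R : ℂ) / 2 * w)
  have h2 := NormedSpace.expSeries_div_hasSum_exp ((R : ℂ) / 2 * w⁻¹)
  have hs := summable_mul_of_summable_norm
    (NormedSpace.norm_expSeries_div_summable ((R : ℂ) / 2 * w))
    (NormedSpace.norm_expSeries_div_summable ((R : ℂ) / 2 * w⁻¹))
  have h3 := h1.mul h2 hs
  rw [← Complex.exp_eq_exp_ℂ, ← Complex.exp_add, ← mul_add] at h3
  have h4 := intProdNatEquiv.hasSum_iff.mpr h3
  refine h4.prod_fiberwise fun n => ?_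
  have h5 := (h4.summable.prod_factor n).hasSum
  refine (congrArg (HasSum _) ?_).mpr h5
  rw [besselI_natCast, Complex.ofReal_tsum, ← tsum_mul_right]
  refine tsum_congr fun m => ?_
  simp only [Function.comp_apply, intProdNatEquiv, Equiv.coe_fn_mk]
  obtain ⟨k, rfl | rfl⟩ := n.eq_nat_or_neg
  · simp [mul_pow, pow_add]
    field_simp
    ring
  · simp [mul_pow, pow_add]
    field_simp
    ring

theorem sum_rootsOfUnity_zpow {p : ℕ} (hp : 1 ≤ p) (z : ℝ) (n : ℤ) :
    ∑ s ∈ Icc 1 p, Complex.exp (((z + 2 * Real.pi * (s : ℝ)) / (p : ℝ) : ℝ) * Complex.I) ^ n =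
      if (p : ℤ) ∣ n then (p : ℂ) * Complex.exp (z / p * Complex.I) ^ n else 0 := by
  have hp0 : (p : ℂ) ≠ 0 := by exact_mod_cast (by omega : p ≠ 0)
  set ω := Complex.exp (2 * Real.pi * Complex.I / p) with hω
  have hprim : IsPrimitiveRoot ω p := Complex.isPrimitiveRoot_exp p (by omega)
  have hterm : ∀ s : ℕ, Complex.exp (((z + 2 * Real.pi * (s : ℝ)) / (p : ℝ) : ℝ) * Complex.I) ^ n
      = Complex.exp (z / p * Complex.I) ^ n * (ω ^ n) ^ s := by
    intro s
    rw [← zpow_natCast (ω ^ n), ← zpow_mul, mul_comm n, zpow_mul, ← mul_zpow]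
    congr 1
    rw [hω, zpow_natCast, ← Complex.exp_nat_mul, ← Complex.exp_add]
    congr 1
    push_cast
    field_simp
  simp_rw [hterm, ← mul_sum]
  split_ifs with h
  · rw [(hprim.zpow_eq_one_iff_dvd n).mpr h]
    simp [mul_comm]
  · have h1 : ω ^ n ≠ 1 := fun h' => h ((hprim.zpow_eq_one_iff_dvd n).mp h')
    have h2 : (ω ^ n) ^ p = 1 := by
      rw [← zpow_natCast, ← zpow_mul, mul_comm, zpow_mul, zpow_natCast, hprim.pow_eq_one, one_zpow]
    have h3 : ∑ s ∈ Icc 1 p, (ω ^ n) ^ s = 0 := by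
      rw [← Finset.Ico_add_one_right_eq_Icc, geom_sum_Ico h1 (by omega), pow_succ, h2]
      simp
    rw [h3, mul_zero]

theorem hasSum_besselI_mul_cos {p : ℕ} (hp : 1 ≤ p) (R z : ℝ) :
    HasSum (fun k : ℕ => 2 * besselI ((p * k : ℕ) : ℝ) R * Real.cos (k * z))
      ((1 / (p : ℝ)) * ∑ s ∈ Icc 1 p,
        Real.exp (R * Real.cos ((z + 2 * Real.pi * (s : ℝ)) / (p : ℝ))) + besselI 0 R) := by
  have hp0 : (p : ℂ) ≠ 0 := by exact_mod_cast (by omega : p ≠ 0)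
  have hinj : Function.Injective fun k : ℤ => (p : ℤ) * k :=
    mul_right_injective₀ (by exact_mod_cast (by omega : p ≠ 0))
  have h1 := (hasSum_sum (s := Icc 1 p) fun s _ => hasSum_besselI_mul_zpow R
    (Complex.exp_ne_zero (((z + 2 * Real.pi * (s : ℝ)) / (p : ℝ) : ℝ) * Complex.I))).mul_left
      (1 / (p : ℂ))
  simp_rw [← mul_sum, sum_rootsOfUnity_zpow hp] at h1
  rw [← hinj.hasSum_iff] at h1
  · have h2 := Complex.reCLM.hasSum h1.nat_add_neg
    convert h2 using 1
    · funext k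
      have e : ∀ m : ℤ, Complex.exp (z / p * Complex.I) ^ ((p : ℤ) * m) =
          Complex.exp ((m * z : ℝ) * Complex.I) := by
        intro m
        rw [← Complex.exp_int_mul]
        congr 1
        push_cast
        field_simp
      simp only [Function.comp_apply, dvd_mul_right, if_true, e, Int.natAbs_mul, Int.natAbs_natCast,
        Int.natAbs_neg, Complex.reCLM_apply, Complex.add_re]
      have e2 : ∀ a b : ℂ, 1 / (p : ℂ) * (a * (p * b)) = a * b := by intros; field_simp
      rw [e2, e2, Complex.re_ofReal_mul, Complex.re_ofReal_mul, Complex.exp_ofReal_mul_I_re,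
        Complex.exp_ofReal_mul_I_re]
      push_cast
      rw [neg_mul, Real.cos_neg]
      ring
    · have e3 : ∀ t : ℝ, Complex.exp (R / 2 * (Complex.exp (t * Complex.I) +
          (Complex.exp (t * Complex.I))⁻¹)) = (Real.exp (R * Real.cos t) : ℝ) := by
        intro t
        rw [← Complex.exp_neg, Complex.ofReal_exp]
        congr 1
        push_cast
        rw [Complex.cos, ← neg_mul]
        ring
      simp_rw [e3]
      rw [← Complex.ofReal_sum]
      simp only [Function.comp_apply, mul_zero, dvd_zero, if_true, zpow_zero, mul_one,
        Int.natAbs_zero, Nat.cast_zero, Complex.reCLM_apply, Complex.add_re]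
      congr 1
      · rw [← Complex.ofReal_natCast, ← Complex.ofReal_one, ← Complex.ofReal_div,
          ← Complex.ofReal_mul, Complex.ofReal_re]
      · rw [mul_comm (besselI 0 R : ℂ), ← mul_assoc, one_div_mul_cancel hp0, one_mul,
          Complex.ofReal_re]
  · intro n hn
    rw [if_neg, mul_zero, mul_zero]
    rintro ⟨k, rfl⟩
    exact hn ⟨k, rfl⟩

/-! ### Gegenbauer polynomials -/

theorem gegenbauerC_succ_eq_sum_choose (n j : ℕ) (x : ℝ) :
    gegenbauerC ((n + 1 : ℕ) : ℝ) j x = ∑ k ∈ range (j + 1),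
      (-1 : ℝ) ^ k * ((n + (j - k)).choose n * (j - k).choose k : ℕ) * (2 * x) ^ (j - 2 * k) := by
  rw [gegenbauerC, ← Finset.sum_subset (s₁ := range (j / 2 + 1)) (s₂ := range (j + 1))]
  · refine sum_congr rfl fun k hk => ?_
    obtain ⟨l, rfl⟩ : ∃ l, j = 2 * k + l :=
      Nat.exists_eq_add_of_le (by have := mem_range.mp hk; omega)
    have e1 : 2 * k + l - k = k + l := by omega
    have e2 : 2 * k + l - 2 * k = l := by omega
    have e3 : ((n + 1 : ℕ) : ℝ) + ((2 * k + l : ℕ) : ℝ) - k = ((n + (k + l) : ℕ) : ℝ) + 1 := by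
      push_cast; ring
    rw [e1, e2, e3, Real.Gamma_nat_eq_factorial, Nat.cast_add_one n, Real.Gamma_nat_eq_factorial]
    congr 1
    rw [mul_div_assoc, Nat.cast_mul, Nat.cast_add_choose, Nat.cast_add_choose]
    have := (k + l).factorial_ne_zero
    field_simp
  · intro k hk
    simp only [mem_range] at *
    omega
  · intro k hk hk'
    simp only [mem_range] at *
    rw [Nat.choose_eq_zero_of_lt (by omega : j - k < k)]
    simp

theorem abs_gegenbauerC_succ_le (n j : ℕ) {x : ℝ} (hx : |x| ≤ 1) :
    |gegenbauerC ((n + 1 : ℕ) : ℝ) j x| ≤ 2 ^ n * 16 ^ j := by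
  rw [gegenbauerC_succ_eq_sum_choose]
  refine (abs_sum_le_sum_abs _ _).trans ?_
  have key : ∀ k ∈ range (j + 1), |(-1 : ℝ) ^ k * ((n + (j - k)).choose n * (j - k).choose k : ℕ) *
      (2 * x) ^ (j - 2 * k)| ≤ 2 ^ n * 8 ^ j := by
    intro k _
    rw [abs_mul, abs_mul, abs_pow, abs_neg, abs_one, one_pow, one_mul, abs_pow, abs_mul,
      Nat.abs_cast, abs_two]
    have h1 : ((n + (j - k)).choose n * (j - k).choose k : ℕ) ≤ 2 ^ (n + j) * 2 ^ j :=
      Nat.mul_le_mul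
        ((Nat.choose_le_two_pow _ _).trans (Nat.pow_le_pow_right (by norm_num) (by omega)))
        ((Nat.choose_le_two_pow _ _).trans (Nat.pow_le_pow_right (by norm_num) (by omega)))
    have h1' : (((n + (j - k)).choose n * (j - k).choose k : ℕ) : ℝ) ≤ 2 ^ (n + j) * 2 ^ j := by
      exact_mod_cast h1
    have h2 : (2 * |x|) ^ (j - 2 * k) ≤ 2 ^ j :=
      (pow_le_pow_left₀ (by positivity) (by linarith) _).trans
        (pow_le_pow_right₀ (by norm_num) (by omega))
    calc _ ≤ ((2 : ℝ) ^ (n + j) * 2 ^ j) * 2 ^ j := by gcongr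
      _ = 2 ^ n * 8 ^ j := by
        rw [pow_add, (by norm_num : (8 : ℝ) = 2 * 2 * 2), mul_pow, mul_pow]; ring
  refine (sum_le_card_nsmul _ _ _ key).trans ?_
  rw [card_range, nsmul_eq_mul]
  have h3 : ((j + 1 : ℕ) : ℝ) ≤ 2 ^ j := by exact_mod_cast Nat.lt_two_pow_self (n := j)
  calc _ ≤ (2 : ℝ) ^ j * (2 ^ n * 8 ^ j) := by gcongr
    _ = 2 ^ n * 16 ^ j := by rw [(by norm_num : (16 : ℝ) = 2 * 8), mul_pow]; ring

theorem gegenbauerC_zero {ν : ℝ} (hν : 0 < ν) (x : ℝ) : gegenbauerC ν 0 x = 1 := by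
  simp [gegenbauerC, (Real.Gamma_pos_of_pos hν).ne']

theorem hasDerivAt_gegenbauerC_succ {ν : ℝ} (hν : 0 < ν) (j : ℕ) (x : ℝ) :
    HasDerivAt (gegenbauerC ν (j + 1)) (2 * ν * gegenbauerC (ν + 1) j x) x := by
  have hterm : ∀ k : ℕ, HasDerivAt (fun x : ℝ => (-1 : ℝ) ^ k *
      Real.Gamma (ν + ((j + 1 : ℕ) : ℝ) - k) / (Real.Gamma ν * k.factorial *
        (j + 1 - 2 * k).factorial) * (2 * x) ^ (j + 1 - 2 * k))
      ((-1 : ℝ) ^ k * Real.Gamma (ν + ((j + 1 : ℕ) : ℝ) - k) / (Real.Gamma ν * k.factorial *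
        (j + 1 - 2 * k).factorial) * (((j + 1 - 2 * k : ℕ) : ℝ) * (2 * x) ^ (j + 1 - 2 * k - 1) *
          (2 * 1))) x :=
    fun k => (((hasDerivAt_id x).const_mul 2).pow _).const_mul _
  have h := HasDerivAt.fun_sum (u := range ((j + 1) / 2 + 1)) fun k _ => hterm k
  refine h.congr_deriv ?_
  rw [gegenbauerC, mul_sum, ← Finset.sum_subset (s₁ := range (j / 2 + 1))
    (s₂ := range ((j + 1) / 2 + 1))]
  · refine sum_congr rfl fun k hk => ?_
    obtain ⟨l, rfl⟩ : ∃ l, j = 2 * k + l :=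
      Nat.exists_eq_add_of_le (by have := mem_range.mp hk; omega)
    have e1 : 2 * k + l + 1 - 2 * k = l + 1 := by omega
    have e2 : 2 * k + l - 2 * k = l := by omega
    have e3 : ν + ((2 * k + l + 1 : ℕ) : ℝ) - k = ν + 1 + ((2 * k + l : ℕ) : ℝ) - k := by
      push_cast; ring
    rw [e1, e2, e3, Real.Gamma_add_one hν.ne', Nat.factorial_succ, Nat.add_sub_cancel]
    have := (Real.Gamma_pos_of_pos hν).ne'
    push_cast
    field_simp
  · intro k hk
    simp only [mem_range] at *
    omega
  · intro k hk hk'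
    simp only [mem_range] at *
    rw [(by omega : j + 1 - 2 * k = 0)]
    simp

theorem gegenbauerC_one_add_two (j : ℕ) (x : ℝ) :
    gegenbauerC 1 (j + 2) x = 2 * x * gegenbauerC 1 (j + 1) x - gegenbauerC 1 j x := by
  have h := fun j => gegenbauerC_succ_eq_sum_choose 0 j x
  simp only [zero_add, Nat.cast_one, Nat.choose_zero_right, one_mul] at h
  rw [h, h, h, sum_range_succ, Nat.choose_eq_zero_of_lt (by omega : j + 2 - (j + 2) < j + 2),
    sum_range_succ', sum_range_succ' _ (j + 1), mul_add]
  have key : ∀ k ∈ range (j + 1),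
      (-1 : ℝ) ^ (k + 1) * ((j + 2 - (k + 1)).choose (k + 1) : ℕ) *
        (2 * x) ^ (j + 2 - 2 * (k + 1)) =
      2 * x * ((-1 : ℝ) ^ (k + 1) * ((j + 1 - (k + 1)).choose (k + 1) : ℕ) *
        (2 * x) ^ (j + 1 - 2 * (k + 1))) -
      (-1 : ℝ) ^ k * ((j - k).choose k : ℕ) * (2 * x) ^ (j - 2 * k) := by
    intro k hk
    have hk' := mem_range.mp hk
    rw [(by omega : j + 2 - (k + 1) = (j - k) + 1), (by omega : j + 1 - (k + 1) = j - k),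
      (by omega : j + 2 - 2 * (k + 1) = j - 2 * k), Nat.choose_succ_succ']
    by_cases hkj : 2 * k + 1 ≤ j
    · rw [(by omega : j - 2 * k = (j + 1 - 2 * (k + 1)) + 1)]
      push_cast
      ring
    · rw [Nat.choose_eq_zero_of_lt (by omega : j - k < k + 1)]
      push_cast
      ring
  rw [sum_congr rfl key, sum_sub_distrib, ← mul_sum]
  simp
  ring

theorem sin_mul_gegenbauerC_one (z : ℝ) (j : ℕ) :
    Real.sin z * gegenbauerC 1 j (Real.cos z) = Real.sin ((j + 1 : ℕ) * z) := by
  induction j using Nat.twoStepInduction with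
  | zero => simp [gegenbauerC_zero one_pos]
  | one =>
    have h := gegenbauerC_succ_eq_sum_choose 0 1 (Real.cos z)
    simp [sum_range_succ] at h
    rw [h]
    norm_num [Real.sin_two_mul]
    ring
  | more j h0 h1 =>
    rw [gegenbauerC_one_add_two, mul_sub, mul_left_comm, h0, h1]
    have e2 : ((j + 2 + 1 : ℕ) : ℝ) * z = ((j + 1 + 1 : ℕ) : ℝ) * z + z := by push_cast; ring
    have e0 : ((j + 1 : ℕ) : ℝ) * z = ((j + 1 + 1 : ℕ) : ℝ) * z - z := by push_cast; ring
    rw [e2, e0, Real.sin_add, Real.sin_sub]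
    ring

/-! ### The Gegenbauer–Bessel series and the operator `L` -/

/-- The general term of the Gegenbauer–Bessel series. -/
noncomputable def besselGegenbauerTerm (p ν : ℕ) (R z : ℝ) (j : ℕ) : ℝ :=
  ((j : ℝ) + (ν : ℝ)) * besselI ((p : ℝ) * ((j : ℝ) + (ν : ℝ))) R *
    gegenbauerC (ν : ℝ) j (Real.cos z)

theorem abs_besselGegenbauerTerm_succ_le (p n : ℕ) (R z : ℝ) (j : ℕ) :
    |besselGegenbauerTerm p (n + 1) R z j| ≤
      2 ^ n * (((j : ℝ) + ((n + 1 : ℕ) : ℝ)) *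
        |besselI ((p : ℝ) * ((j : ℝ) + ((n + 1 : ℕ) : ℝ))) R| * 16 ^ j) := by
  have h := abs_gegenbauerC_succ_le n j (Real.abs_cos_le_one z)
  rw [besselGegenbauerTerm, abs_mul, abs_mul,
    abs_of_nonneg (by positivity : 0 ≤ (j : ℝ) + ((n + 1 : ℕ) : ℝ))]
  calc _ ≤ ((j : ℝ) + ((n + 1 : ℕ) : ℝ)) *
        |besselI ((p : ℝ) * ((j : ℝ) + ((n + 1 : ℕ) : ℝ))) R| * (2 ^ n * 16 ^ j) := by gcongr
    _ = _ := by ring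

theorem summable_besselGegenbauerTerm_succ {p : ℕ} (hp : 1 ≤ p) (n : ℕ) {R : ℝ} (hR : 0 < R)
    (z : ℝ) : Summable (besselGegenbauerTerm p (n + 1) R z) :=
  Summable.of_norm_bounded
    ((summable_mul_pow_mul_abs_besselI hp hR (by norm_num : (1 : ℝ) ≤ 16) (n + 1)).mul_left (2 ^ n))
    fun j => abs_besselGegenbauerTerm_succ_le p n R z j

theorem hasDerivAt_tsum_besselGegenbauerTerm {p : ℕ} (hp : 1 ≤ p) (n : ℕ) {R : ℝ} (hR : 0 < R)
    (z : ℝ) : HasDerivAt (fun z => ∑' j, besselGegenbauerTerm p (n + 1) R z j)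
      (-(Real.sin z * (2 * (n + 1) * ∑' j, besselGegenbauerTerm p (n + 2) R z j))) z := by
  have hn : (0 : ℝ) < ((n + 1 : ℕ) : ℝ) := by positivity
  have hsplit : (fun z => ∑' j, besselGegenbauerTerm p (n + 1) R z j) = fun z =>
      besselGegenbauerTerm p (n + 1) R 0 0 + ∑' j, besselGegenbauerTerm p (n + 1) R z (j + 1) := by
    funext z
    rw [(summable_besselGegenbauerTerm_succ hp n hR z).tsum_eq_zero_add]
    simp only [besselGegenbauerTerm, gegenbauerC_zero hn]
  rw [hsplit, ← tsum_mul_left, ← tsum_mul_left, ← tsum_neg]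
  refine HasDerivAt.const_add _ ?_
  refine hasDerivAt_tsum (y₀ := 0)
    (g' := fun j z => -(Real.sin z * (2 * (n + 1) * besselGegenbauerTerm p (n + 2) R z j)))
    (((summable_mul_pow_mul_abs_besselI hp hR (by norm_num : (1 : ℝ) ≤ 16) (n + 2)).mul_left
      (2 ^ (n + 1))).mul_left (2 * ((n : ℝ) + 1))) (fun j y => ?_) (fun j y => ?_) ?_ z
  · have h := ((hasDerivAt_gegenbauerC_succ hn j (Real.cos y)).comp y
      (Real.hasDerivAt_cos y)).const_mul ((((j + 1 : ℕ) : ℝ) + ((n + 1 : ℕ) : ℝ)) *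
        besselI ((p : ℝ) * (((j + 1 : ℕ) : ℝ) + ((n + 1 : ℕ) : ℝ))) R)
    refine h.congr_deriv ?_
    have e : ((j + 1 : ℕ) : ℝ) + ((n + 1 : ℕ) : ℝ) = (j : ℝ) + ((n + 2 : ℕ) : ℝ) := by
      push_cast; ring
    have e' : ((n + 1 : ℕ) : ℝ) + 1 = ((n + 2 : ℕ) : ℝ) := by push_cast; ring
    rw [e, e', besselGegenbauerTerm]
    push_cast
    ring
  · rw [norm_neg, norm_mul, norm_mul, Real.norm_eq_abs, Real.norm_eq_abs, Real.norm_eq_abs,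
      abs_of_nonneg (by positivity : (0 : ℝ) ≤ 2 * (n + 1))]
    calc _ ≤ 1 * (2 * ((n : ℝ) + 1) * |besselGegenbauerTerm p (n + 2) R y j|) := by
          gcongr; exact Real.abs_sin_le_one y
      _ ≤ _ := by
          rw [one_mul]; gcongr; exact abs_besselGegenbauerTerm_succ_le p (n + 1) R y j
  · exact (summable_nat_add_iff 1).mpr (summable_besselGegenbauerTerm_succ hp n hR 0)

theorem hasDerivAt_average_exp_cos {p : ℕ} (hp : 1 ≤ p) {R : ℝ} (hR : 0 < R) (z : ℝ) :
    HasDerivAt (fun z => (1 / (p : ℝ)) * ∑ s ∈ Icc 1 p,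
        Real.exp (R * Real.cos ((z + 2 * Real.pi * (s : ℝ)) / (p : ℝ))))
      (-(Real.sin z * (2 * ∑' j, besselGegenbauerTerm p 1 R z j))) z := by
  have hsplit : (fun z => (1 / (p : ℝ)) * ∑ s ∈ Icc 1 p,
        Real.exp (R * Real.cos ((z + 2 * Real.pi * (s : ℝ)) / (p : ℝ)))) = fun z =>
      besselI 0 R +
        ∑' j : ℕ, 2 * besselI ((p * (j + 1) : ℕ) : ℝ) R * Real.cos ((j + 1 : ℕ) * z) := by
    funext z
    have h := hasSum_besselI_mul_cos hp R z
    have h' := h.tsum_eq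
    rw [h.summable.tsum_eq_zero_add] at h'
    simp only [mul_zero, Nat.cast_zero, zero_mul, Real.cos_zero, mul_one] at h'
    linarith
  rw [hsplit, ← tsum_mul_left, ← tsum_mul_left, ← tsum_neg]
  refine HasDerivAt.const_add _ ?_
  refine hasDerivAt_tsum (y₀ := 0)
    (g' := fun j z => -(Real.sin z * (2 * besselGegenbauerTerm p 1 R z j)))
    (((summable_mul_pow_mul_abs_besselI hp hR (by norm_num : (1 : ℝ) ≤ 16) 1).mul_left
      (2 ^ 0)).mul_left 2) (fun j y => ?_) (fun j y => ?_) ?_ z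
  · have h := (((hasDerivAt_id y).const_mul ((j + 1 : ℕ) : ℝ)).cos).const_mul
      (2 * besselI ((p * (j + 1) : ℕ) : ℝ) R)
    refine h.congr_deriv ?_
    have hs := sin_mul_gegenbauerC_one y j
    simp only [id, mul_one]
    rw [← hs, besselGegenbauerTerm]
    push_cast
    ring
  · rw [norm_neg, norm_mul, norm_mul, Real.norm_eq_abs, Real.norm_eq_abs, Real.norm_eq_abs,
      abs_two]
    calc _ ≤ 1 * (2 * |besselGegenbauerTerm p 1 R y j|) := by
          gcongr; exact Real.abs_sin_le_one y
      _ ≤ _ := by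
          rw [one_mul]; gcongr; exact abs_besselGegenbauerTerm_succ_le p 0 R y j
  · exact (summable_nat_add_iff 1).mpr (hasSum_besselI_mul_cos hp R 0).summable

theorem Lop_eq_of_hasDerivAt {g : ℝ → ℝ} {c z : ℝ} (hz : Real.sin z ≠ 0)
    (h : HasDerivAt g (-(Real.sin z * c)) z) : Lop g z = c := by
  rw [Lop, h.deriv, neg_neg, mul_div_cancel_left₀ _ hz]

theorem Lop_iterate_average_exp_cos {p : ℕ} (hp : 1 ≤ p) {R : ℝ} (hR : 0 < R) (n : ℕ) :
    ∀ z ∈ Set.Ioo 0 Real.pi, Lop^[n + 1] (fun z => (1 / (p : ℝ)) * ∑ s ∈ Icc 1 p,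
        Real.exp (R * Real.cos ((z + 2 * Real.pi * (s : ℝ)) / (p : ℝ)))) z =
      2 ^ (n + 1) * n.factorial * ∑' j, besselGegenbauerTerm p (n + 1) R z j := by
  induction n with
  | zero =>
    intro z hz
    have := Lop_eq_of_hasDerivAt (Real.sin_pos_of_mem_Ioo hz).ne' (hasDerivAt_average_exp_cos hp hR z)
    simpa using this
  | succ n ih =>
    intro z hz
    rw [Function.iterate_succ_apply']
    refine Lop_eq_of_hasDerivAt (Real.sin_pos_of_mem_Ioo hz).ne' ?_
    refine (((hasDerivAt_tsum_besselGegenbauerTerm hp n hR z).const_mul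
      (2 ^ (n + 1) * (n.factorial : ℝ))).congr_of_eventuallyEq ?_).congr_deriv ?_
    · filter_upwards [isOpen_Ioo.mem_nhds hz] with y hy using ih y hy
    · rw [Nat.factorial_succ]
      push_cast
      ring

theorem stmt0 (p ν : ℕ) (hp : 1 ≤ p) (hν : 1 ≤ ν) (R : ℝ) (hR : 0 < R)
    (ζ : ℝ) (hζ : ζ ∈ Set.Ioo 0 Real.pi) :
    Summable (fun j : ℕ =>
      ((j : ℝ) + (ν : ℝ)) * besselI ((p : ℝ) * ((j : ℝ) + (ν : ℝ))) R *
        gegenbauerC (ν : ℝ) j (Real.cos ζ)) ∧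
    ∑' j : ℕ, ((j : ℝ) + (ν : ℝ)) * besselI ((p : ℝ) * ((j : ℝ) + (ν : ℝ))) R *
        gegenbauerC (ν : ℝ) j (Real.cos ζ) =
      (1 / (2 ^ ν * (Nat.factorial (ν - 1) : ℝ))) *
        Lop^[ν] (fun z =>
          (1 / (p : ℝ)) * ∑ s ∈ Finset.Icc 1 p,
            Real.exp (R * Real.cos ((z + 2 * Real.pi * (s : ℝ)) / (p : ℝ)))) ζ := by
  obtain ⟨n, rfl⟩ : ∃ n, ν = n + 1 := ⟨ν - 1, by omega⟩
  refine ⟨summable_besselGegenbauerTerm_succ hp n hR ζ, ?_⟩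
  rw [Lop_iterate_average_exp_cos hp hR n ζ hζ, Nat.add_sub_cancel, ← mul_assoc,
    one_div_mul_cancel (by positivity), one_mul]
  rfl
end

section
/- For every integer p ≥ 1, every R ≥ 0 and every real t, one has 2 Σ_{j=0}^∞ I_{pj}(R) cos(jt) = I_0(R) + (1/p) Σ_{s=1}^p exp( R cos((t+2πs)/p) ). -/
/-- Modified Bessel function of the first kind of integer order `n ≥ 0`. -/
noncomputable def besselIN (n : ℕ) (R : ℝ) : ℝ :=
  ∑' m : ℕ, (R / 2) ^ (2 * m + n) / (Nat.factorial m * Nat.factorial (m + n))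

/-- A summable symmetric family on `ℕ × ℕ`, summed along the lines parallel to the diagonal. -/
theorem hasSum_offDiagonal_of_symm {f : ℕ × ℕ → ℝ} {S : ℝ} (hf : HasSum f S)
    (hsymm : ∀ a b, f (a, b) = f (b, a)) :
    HasSum (fun n : ℕ => ∑' m : ℕ, f (m + n, m)) ((S + ∑' m : ℕ, f (m, m)) / 2) := by
  have hinj : Function.Injective (fun q : ℕ × ℕ => (q.2 + q.1, q.2)) := by
    rintro ⟨a, b⟩ ⟨c, d⟩ h
    simp only [Prod.mk.injEq] at h ⊢
    omega
  have hdiag : Function.Injective (fun m : ℕ => (m, m)) := fun a b h => (Prod.mk.inj h).1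
  have hshift : Summable (fun q : ℕ × ℕ => f (q.2 + q.1, q.2)) := hf.summable.comp_injective hinj
  set L := ∑' q : ℕ × ℕ, f (q.2 + q.1, q.2) with hL
  have hlower : HasSum (fun q : ℕ × ℕ => if q.2 ≤ q.1 then f q else 0) L := by
    refine (hinj.hasSum_iff ?_).1 ?_
    · rintro ⟨a, b⟩ hq
      exact if_neg fun hle => hq ⟨(a - b, b), Prod.ext (Nat.add_sub_of_le hle) rfl⟩
    · simpa [Function.comp_def] using hshift.hasSum
  have hupper : HasSum (fun q : ℕ × ℕ => if q.1 ≤ q.2 then f q else 0) L := by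
    refine ((Equiv.prodComm ℕ ℕ).hasSum_iff.2 hlower).congr_fun ?_
    rintro ⟨a, b⟩
    simp [hsymm a b]
  have hmid : HasSum (fun q : ℕ × ℕ => if q.1 = q.2 then f q else 0) (∑' m : ℕ, f (m, m)) := by
    refine (hdiag.hasSum_iff ?_).1 ?_
    · rintro ⟨a, b⟩ hq
      exact if_neg fun h : a = b => hq ⟨a, by simp [h]⟩
    · simpa [Function.comp_def] using (hf.summable.comp_injective hdiag).hasSum
  have htotal : S = L + L - ∑' m : ℕ, f (m, m) := by
    refine hf.unique (((hlower.add hupper).sub hmid).congr_fun ?_)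
    rintro ⟨a, b⟩
    rcases lt_trichotomy a b with h | h | h
    · simp [h.le, h.not_ge, h.ne]
    · simp [h]
    · simp [h.le, h.not_ge, h.ne']
  have hS : (S + ∑' m : ℕ, f (m, m)) / 2 = L := by linarith
  rw [hS]
  exact hshift.hasSum.prod_fiberwise fun n => (hshift.prod_factor n).hasSum

theorem re_exp_term_mul_exp_term (r θ : ℝ) (a b : ℕ) :
    ((r * Complex.exp (θ * Complex.I)) ^ a / (Nat.factorial a : ℂ) *
      ((r * Complex.exp (-θ * Complex.I)) ^ b / (Nat.factorial b : ℂ))).re =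
    r ^ (a + b) / (Nat.factorial a * Nat.factorial b) * Real.cos (((a : ℝ) - b) * θ) := by
  have hz : Complex.exp ((((a : ℝ) - b) * θ : ℝ) * Complex.I) =
      Complex.exp (θ * Complex.I) ^ a * Complex.exp (-θ * Complex.I) ^ b := by
    rw [← Complex.exp_nat_mul, ← Complex.exp_nat_mul, ← Complex.exp_add]
    congr 1
    push_cast
    ring
  rw [← Complex.exp_ofReal_mul_I_re, ← Complex.re_ofReal_mul, hz]
  congr 1
  push_cast
  ring

theorem exp_mul_exp_conj (r θ : ℝ) :
    Complex.exp (r * Complex.exp (θ * Complex.I)) *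
      Complex.exp (r * Complex.exp (-θ * Complex.I)) =
    (Real.exp (2 * r * Real.cos θ) : ℂ) := by
  rw [← Complex.exp_add, Complex.ofReal_exp]
  congr 1
  push_cast [Complex.cos]
  ring

/-- The expansion of `exp (R cos θ)` coming from `exp (r z) * exp (r z⁻¹)` with `z = exp (iθ)`,
`r = R / 2`. -/
theorem hasSum_exp_mul_cos (R θ : ℝ) :
    HasSum (fun q : ℕ × ℕ => (R / 2) ^ (q.1 + q.2) / (Nat.factorial q.1 * Nat.factorial q.2) *
      Real.cos (((q.1 : ℝ) - q.2) * θ)) (Real.exp (R * Real.cos θ)) := by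
  have hexp (z : ℂ) : HasSum (fun n : ℕ => z ^ n / (Nat.factorial n : ℂ)) (Complex.exp z) := by
    rw [Complex.exp_eq_exp_ℂ]
    exact NormedSpace.expSeries_div_hasSum_exp z
  have hnorm (z : ℂ) : Summable (fun n : ℕ => ‖z ^ n / (Nat.factorial n : ℂ)‖) :=
    NormedSpace.norm_expSeries_div_summable z
  have hprod (u v : ℂ) : HasSum (fun q : ℕ × ℕ => u ^ q.1 / (Nat.factorial q.1 : ℂ) *
      (v ^ q.2 / (Nat.factorial q.2 : ℂ))) (Complex.exp u * Complex.exp v) := by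
    have hs := summable_mul_of_summable_norm (hnorm u) (hnorm v)
    have h := (hexp u).mul (hexp v) hs
    exact h
  have h := Complex.hasSum_re (hprod ((R / 2 : ℝ) * Complex.exp (θ * Complex.I))
    ((R / 2 : ℝ) * Complex.exp (-θ * Complex.I)))
  simp only [re_exp_term_mul_exp_term, exp_mul_exp_conj, Complex.ofReal_re] at h
  rwa [mul_div_cancel₀ R two_ne_zero] at h

/-- The Fourier cosine series of `exp (R cos θ)`. -/
theorem hasSum_besselIN_mul_cos (R θ : ℝ) :
    HasSum (fun n : ℕ => besselIN n R * Real.cos (n * θ))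
      ((Real.exp (R * Real.cos θ) + besselIN 0 R) / 2) := by
  have h := hasSum_offDiagonal_of_symm (hasSum_exp_mul_cos R θ) fun a b => by
    dsimp only
    rw [← Real.cos_neg, add_comm a b, mul_comm (Nat.factorial a : ℝ)]
    congr 2
    ring
  have hzero : besselIN 0 R = ∑' m : ℕ, (R / 2) ^ (m + m) /
      (Nat.factorial m * Nat.factorial m) * Real.cos (((m : ℝ) - m) * θ) := by
    simp [besselIN, two_mul]
  rw [hzero]
  refine h.congr_fun fun n => ?_
  rw [besselIN, ← tsum_mul_right]
  refine tsum_congr fun m => ?_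
  have hpow : m + n + m = 2 * m + n := by ring
  have harg : ((m + n : ℕ) : ℝ) - m = n := by push_cast; ring
  simp only [hpow, harg, mul_comm (Nat.factorial m : ℝ)]

theorem sum_cos_eq_zero_of_not_dvd {p n : ℕ} (hp : p ≠ 0) (hn : ¬ p ∣ n) (t : ℝ) :
    ∑ s ∈ Finset.Icc 1 p, Real.cos (n * ((t + 2 * Real.pi * (s : ℝ)) / p)) = 0 := by
  have hp' : (p : ℂ) ≠ 0 := Nat.cast_ne_zero.2 hp
  have hζ := Complex.isPrimitiveRoot_exp p hp
  set ζ := Complex.exp (2 * Real.pi * Complex.I / p) with hζdef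
  have hne : ζ ^ n - 1 ≠ 0 := sub_ne_zero.2 fun h => hn (hζ.dvd_of_pow_eq_one n h)
  have hgeom : ∑ s ∈ Finset.range p, (ζ ^ n) ^ s = 0 := by
    have h := geom_sum_mul (ζ ^ n) p
    rw [← pow_mul, mul_comm n p, pow_mul, hζ.pow_eq_one, one_pow, sub_self] at h
    exact (mul_eq_zero.1 h).resolve_right hne
  have hterm (s : ℕ) : Real.cos (n * ((t + 2 * Real.pi * (s : ℝ)) / p)) =
      (Complex.exp (n * t / p * Complex.I) * (ζ ^ n) ^ s).re := by
    rw [← Complex.exp_ofReal_mul_I_re, hζdef, ← Complex.exp_nat_mul, ← Complex.exp_nat_mul,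
      ← Complex.exp_add]
    congr 2
    push_cast
    field_simp
  simp only [hterm]
  rw [← Complex.re_sum, ← Finset.mul_sum, ← Finset.Ico_succ_right_eq_Icc,
    Finset.sum_Ico_eq_sum_range]
  simp [pow_add, ← Finset.mul_sum, hgeom]

theorem sum_cos_mul_eq {p : ℕ} (hp : p ≠ 0) (j : ℕ) (t : ℝ) :
    ∑ s ∈ Finset.Icc 1 p, Real.cos ((p * j : ℕ) * ((t + 2 * Real.pi * (s : ℝ)) / p)) =
      p * Real.cos (j * t) := by
  have hp' : (p : ℝ) ≠ 0 := Nat.cast_ne_zero.2 hp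
  have hterm (s : ℕ) : Real.cos ((p * j : ℕ) * ((t + 2 * Real.pi * (s : ℝ)) / p)) =
      Real.cos (j * t) := by
    rw [← Real.cos_add_nat_mul_two_pi (j * t) (j * s)]
    congr 1
    push_cast
    field_simp
  simp only [hterm, Finset.sum_const, Nat.card_Icc, add_tsub_cancel_right, nsmul_eq_mul]

theorem stmt2 (p : ℕ) (hp : 1 ≤ p) (R : ℝ) (hR : 0 ≤ R) (t : ℝ) :
    2 * ∑' j : ℕ, besselIN (p * j) R * Real.cos ((j : ℝ) * t) =
      besselIN 0 R + (1 / (p : ℝ)) * ∑ s ∈ Finset.Icc 1 p,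
        Real.exp (R * Real.cos ((t + 2 * Real.pi * (s : ℝ)) / (p : ℝ))) := by
  have hp0 : p ≠ 0 := by omega
  have hp' : (p : ℝ) ≠ 0 := Nat.cast_ne_zero.2 hp0
  have hsum := hasSum_sum fun (s : ℕ) (_ : s ∈ Finset.Icc 1 p) =>
    hasSum_besselIN_mul_cos R ((t + 2 * Real.pi * (s : ℝ)) / p)
  simp only [← Finset.mul_sum] at hsum
  have hinj : Function.Injective (fun j : ℕ => p * j) := fun a b h =>
    Nat.eq_of_mul_eq_mul_left hp h
  have hmult := (hinj.hasSum_iff fun n hn => by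
    rw [sum_cos_eq_zero_of_not_dvd hp0 (fun ⟨j, hj⟩ => hn ⟨j, hj.symm⟩), mul_zero]).2 hsum
  have htsum := (hmult.mul_left (1 / (p : ℝ))).tsum_eq
  simp only [Function.comp_def, sum_cos_mul_eq hp0] at htsum
  have hterm (j : ℕ) : 1 / (p : ℝ) * (besselIN (p * j) R * (p * Real.cos (j * t))) =
      besselIN (p * j) R * Real.cos (j * t) := by
    field_simp
  simp only [hterm] at htsum
  rw [htsum, ← Finset.sum_div, Finset.sum_add_distrib, Finset.sum_const, Nat.card_Icc]
  simp only [add_tsub_cancel_right, nsmul_eq_mul]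
  field_simp
  ring
end

section
/- For all integers p ≥ 1 and m ≥ 1 and every R ≥ 0, one has (1/π) ∫_0^π cos(mt) · (1/p) Σ_{s=1}^p exp( R cos((t+2πs)/p) ) dt = I_{pm}(R). -/
open MeasureTheory intervalIntegral in
/-- Orthogonality of the exponentials `u ↦ exp (i n u)` to the constants on `[0, 2π]`. -/
lemma integral_cexp_int_mul_I (n : ℤ) :
    ∫ u in (0 : ℝ)..2 * Real.pi, Complex.exp (((n : ℂ) * Complex.I) * u) =
      if n = 0 then 2 * (Real.pi : ℂ) else 0 := by
  split_ifs with h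
  · simp [h]
  · have hc : (n : ℂ) * Complex.I ≠ 0 := mul_ne_zero (by exact_mod_cast h) Complex.I_ne_zero
    rw [integral_exp_mul_complex hc]
    have h1 : Complex.exp (((n : ℂ) * Complex.I) * ((2 * Real.pi : ℝ) : ℂ)) = 1 := by
      rw [Complex.exp_eq_one_iff]
      exact ⟨n, by push_cast; ring⟩
    rw [h1]
    simp

/-- The Laurent expansion of `exp (R cos u)` in powers of `exp (i u)`, multiplied by
`exp (i N u)`. -/
lemma hasSum_cexp_mul_cexp_cos (N : ℕ) (R u : ℝ) :
    HasSum (fun q : ℕ × ℕ => (((R / 2) ^ (q.1 + q.2) / (q.1.factorial * q.2.factorial) : ℝ) : ℂ) *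
        Complex.exp ((((N + q.1 - q.2 : ℤ) : ℂ) * Complex.I) * u))
      (Complex.exp ((N : ℂ) * Complex.I * u) * Complex.exp (R * Complex.cos u)) := by
  have hexp (z : ℂ) : HasSum (fun n : ℕ => z ^ n / n.factorial) (Complex.exp z) := by
    rw [Complex.exp_eq_exp_ℂ]
    exact NormedSpace.expSeries_div_hasSum_exp z
  have hs (z : ℂ) : Summable (fun n : ℕ => ‖z ^ n / n.factorial‖) :=
    NormedSpace.norm_expSeries_div_summable z
  obtain ⟨x, hx⟩ : ∃ x, x = R / 2 * Complex.exp (Complex.I * u) := ⟨_, rfl⟩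
  obtain ⟨y, hy⟩ : ∃ y, y = R / 2 * Complex.exp (-(Complex.I * u)) := ⟨_, rfl⟩
  have hxy : Complex.exp (R * Complex.cos u) = Complex.exp x * Complex.exp y := by
    rw [← Complex.exp_add, hx, hy, Complex.cos]
    ring_nf
  have hprod : Summable (fun q : ℕ × ℕ => x ^ q.1 / q.1.factorial * (y ^ q.2 / q.2.factorial)) :=
    summable_mul_of_summable_norm (f := fun n : ℕ => x ^ n / n.factorial)
      (g := fun n : ℕ => y ^ n / n.factorial) (hs x) (hs y)
  have key : HasSum (fun q : ℕ × ℕ => Complex.exp ((N : ℂ) * Complex.I * u) *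
      (x ^ q.1 / q.1.factorial * (y ^ q.2 / q.2.factorial)))
      (Complex.exp ((N : ℂ) * Complex.I * u) * (Complex.exp x * Complex.exp y)) :=
    ((hexp x).mul (hexp y) hprod).mul_left _
  rw [hxy]
  convert key using 2 with q
  have he : Complex.exp ((((N + q.1 - q.2 : ℤ) : ℂ) * Complex.I) * u) =
      Complex.exp ((N : ℂ) * Complex.I * u) * Complex.exp (Complex.I * u) ^ q.1 *
        Complex.exp (-(Complex.I * u)) ^ q.2 := by
    rw [← Complex.exp_nat_mul, ← Complex.exp_nat_mul, ← Complex.exp_add, ← Complex.exp_add]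
    congr 1
    push_cast
    ring
  rw [he, hx, hy, mul_pow, mul_pow]
  push_cast
  ring

open MeasureTheory intervalIntegral in
lemma integral_cexp_mul_cexp_cos (N : ℕ) (R : ℝ) :
    ∫ u in (0 : ℝ)..2 * Real.pi,
      Complex.exp ((N : ℂ) * Complex.I * u) * Complex.exp (R * Complex.cos u) =
        ((2 * Real.pi * besselIN N R : ℝ) : ℂ) := by
  have hsum : Summable (fun q : ℕ × ℕ =>
      ‖(R / 2) ^ (q.1 + q.2) / (q.1.factorial * q.2.factorial : ℝ)‖) := by
    have h := NormedSpace.norm_expSeries_div_summable (R / 2)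
    convert h.mul_of_nonneg h (fun _ => norm_nonneg _) (fun _ => norm_nonneg _) using 2 with q
    rw [← norm_mul, pow_add, div_mul_div_comm]
  have key := hasSum_integral_of_dominated_convergence (μ := volume)
    (a := 0) (b := 2 * Real.pi)
    (F := fun (q : ℕ × ℕ) (u : ℝ) =>
      (((R / 2) ^ (q.1 + q.2) / (q.1.factorial * q.2.factorial) : ℝ) : ℂ) *
        Complex.exp ((((N + q.1 - q.2 : ℤ) : ℂ) * Complex.I) * u))
    (bound := fun q _ => ‖(R / 2) ^ (q.1 + q.2) / (q.1.factorial * q.2.factorial : ℝ)‖)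
    (fun q => (by fun_prop : Continuous _).aestronglyMeasurable)
    (fun q => Filter.Eventually.of_forall fun u _ => by
      have h1 : ‖Complex.exp ((((N + q.1 - q.2 : ℤ) : ℂ) * Complex.I) * u)‖ = 1 := by
        rw [Complex.norm_exp]
        simp
      rw [norm_mul, h1, mul_one, Complex.norm_real])
    (Filter.Eventually.of_forall fun _ _ => hsum)
    intervalIntegrable_const
    (Filter.Eventually.of_forall fun u _ => hasSum_cexp_mul_cexp_cos N R u)
  rw [← key.tsum_eq]
  simp only [intervalIntegral.integral_const_mul, integral_cexp_int_mul_I]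
  have hinj : Function.Injective (fun l : ℕ => (l, l + N)) := fun a b h => (Prod.ext_iff.1 h).1
  rw [← hinj.tsum_eq, besselIN, ← tsum_mul_left, Complex.ofReal_tsum]
  · refine tsum_congr fun l => ?_
    rw [if_pos (by push_cast; ring), show l + (l + N) = 2 * l + N by ring]
    push_cast
    ring
  · rintro ⟨a, b⟩ h
    refine ⟨a, ?_⟩
    by_contra hne
    refine h ?_
    dsimp only
    rw [if_neg, mul_zero]
    intro h0
    apply hne
    ext <;> simp at h0 ⊢
    omega

/-- The integral representation of the modified Bessel function of integer order. -/
lemma integral_cos_mul_exp_cos (N : ℕ) (R : ℝ) :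
    ∫ u in (0 : ℝ)..2 * Real.pi, Real.cos (N * u) * Real.exp (R * Real.cos u) =
      2 * Real.pi * besselIN N R := by
  have h := congrArg Complex.re (integral_cexp_mul_cexp_cos N R)
  rw [Complex.ofReal_re] at h
  rw [← h, ← Complex.reCLM_apply, ← ContinuousLinearMap.intervalIntegral_comp_comm]
  · refine intervalIntegral.integral_congr fun u _ => ?_
    have h1 : Complex.exp (R * Complex.cos u) = ((Real.exp (R * Real.cos u) : ℝ) : ℂ) := by
      push_cast
      rfl
    have h2 : Complex.exp ((N : ℂ) * Complex.I * u) =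
        Complex.exp (((N * u : ℝ) : ℂ) * Complex.I) := by
      congr 1
      push_cast
      ring
    simp only [Complex.reCLM_apply]
    rw [h1, h2, Complex.re_mul_ofReal, Complex.exp_ofReal_mul_I_re]
  · exact (by fun_prop : Continuous _).intervalIntegrable _ _

/-- Folding an even `2π`-periodic function: averaging its `p` rescaled translates over a half period
recovers half of its integral over a period. -/
lemma integral_sum_translates_eq_half {g : ℝ → ℝ} (hg : Continuous g) (heven : ∀ u, g (-u) = g u)
    (hper : Function.Periodic g (2 * Real.pi)) {p : ℕ} (hp : p ≠ 0) :
    ∫ t in (0 : ℝ)..Real.pi, (1 / (p : ℝ)) * ∑ s ∈ Finset.range p,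
        g ((t + 2 * Real.pi * (s : ℝ)) / (p : ℝ)) =
      (1 / 2) * ∫ u in (0 : ℝ)..2 * Real.pi, g u := by
  have hp' : (p : ℝ) ≠ 0 := by exact_mod_cast hp
  set G : ℝ → ℝ := fun t => (1 / (p : ℝ)) * ∑ s ∈ Finset.range p,
    g ((t + 2 * Real.pi * (s : ℝ)) / (p : ℝ)) with hG
  have hGc : Continuous G := by fun_prop
  have hrefl (t : ℝ) : G (2 * Real.pi - t) = G t := by
    simp only [hG]
    rw [← Finset.sum_range_reflect]
    congr 1
    refine Finset.sum_congr rfl fun s hs => ?_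
    have hs' : s + 1 ≤ p := Finset.mem_range.1 hs
    rw [← heven, ← hper]
    congr 1
    rw [show p - 1 - s = p - (s + 1) by omega, Nat.cast_sub hs']
    field_simp
    push_cast
    ring
  have hhalf : ∫ t in Real.pi..2 * Real.pi, G t = ∫ t in (0 : ℝ)..Real.pi, G t := by
    have h := intervalIntegral.integral_comp_sub_left (a := 0) (b := Real.pi) G (2 * Real.pi)
    simp only [hrefl] at h
    rw [h]
    congr 1 <;> ring
  have hfull : ∫ t in (0 : ℝ)..2 * Real.pi, G t = ∫ u in (0 : ℝ)..2 * Real.pi, g u := by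
    have hterm (s : ℕ) : ∫ t in (0 : ℝ)..2 * Real.pi, g ((t + 2 * Real.pi * (s : ℝ)) / (p : ℝ)) =
        p * ∫ u in (2 * Real.pi * (s : ℝ) / p)..(2 * Real.pi * ((s + 1 : ℕ) : ℝ) / p), g u := by
      simp only [add_div]
      rw [intervalIntegral.integral_comp_div_add _ hp', smul_eq_mul]
      congr 2
      · ring
      · push_cast
        ring
    simp only [hG]
    rw [intervalIntegral.integral_const_mul, intervalIntegral.integral_finsetSum
      (fun s _ => (by fun_prop : Continuous _).intervalIntegrable _ _)]
    simp only [hterm]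
    rw [← Finset.mul_sum, intervalIntegral.sum_integral_adjacent_intervals
      (a := fun s : ℕ => 2 * Real.pi * (s : ℝ) / p) (fun s _ => hg.intervalIntegrable _ _),
      ← mul_assoc, one_div_mul_cancel hp', one_mul]
    congr 1
    · simp
    · field_simp
  have hadd := intervalIntegral.integral_add_adjacent_intervals
    (hGc.intervalIntegrable (μ := MeasureTheory.volume) 0 Real.pi)
    (hGc.intervalIntegrable Real.pi (2 * Real.pi))
  linarith

theorem stmt5 (p m : ℕ) (hp : 1 ≤ p) (hm : 1 ≤ m) (R : ℝ) (hR : 0 ≤ R) :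
    (1 / Real.pi) * ∫ t in (0 : ℝ)..Real.pi,
        Real.cos ((m : ℝ) * t) * ((1 / (p : ℝ)) * ∑ s ∈ Finset.Icc 1 p,
          Real.exp (R * Real.cos ((t + 2 * Real.pi * (s : ℝ)) / (p : ℝ)))) =
      besselIN (p * m) R := by
  have hp0 : p ≠ 0 := by omega
  have hp' : (p : ℝ) ≠ 0 := by exact_mod_cast hp0
  set g : ℝ → ℝ := fun u => Real.cos ((p * m : ℕ) * u) * Real.exp (R * Real.cos u) with hg
  have hper : Function.Periodic g (2 * Real.pi) := fun u => by
    simp only [hg]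
    rw [Real.cos_add_two_pi, mul_add, Real.cos_add_nat_mul_two_pi]
  have hfold := integral_sum_translates_eq_half (g := g) (by fun_prop) (fun u => by simp [hg])
    hper hp0
  rw [integral_cos_mul_exp_cos] at hfold
  have hint (t : ℝ) : Real.cos ((m : ℝ) * t) * ((1 / (p : ℝ)) * ∑ s ∈ Finset.Icc 1 p,
      Real.exp (R * Real.cos ((t + 2 * Real.pi * (s : ℝ)) / (p : ℝ)))) =
      (1 / (p : ℝ)) * ∑ s ∈ Finset.range p, g ((t + 2 * Real.pi * (s : ℝ)) / (p : ℝ)) := by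
    have hterm (s : ℕ) : g ((t + 2 * Real.pi * (s : ℝ)) / (p : ℝ)) = Real.cos ((m : ℝ) * t) *
        Real.exp (R * Real.cos ((t + 2 * Real.pi * (s : ℝ)) / (p : ℝ))) := by
      have harg : ((p * m : ℕ) : ℝ) * ((t + 2 * Real.pi * (s : ℝ)) / (p : ℝ)) =
          m * t + (m * s : ℕ) * (2 * Real.pi) := by
        push_cast
        field_simp
      simp only [hg]
      rw [harg, Real.cos_add_nat_mul_two_pi]
    have hshift : ∑ s ∈ Finset.range p, g ((t + 2 * Real.pi * (s : ℝ)) / (p : ℝ)) =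
        ∑ s ∈ Finset.Icc 1 p, g ((t + 2 * Real.pi * (s : ℝ)) / (p : ℝ)) := by
      have hends : g ((t + 2 * Real.pi * (p : ℝ)) / (p : ℝ)) =
          g ((t + 2 * Real.pi * ((0 : ℕ) : ℝ)) / (p : ℝ)) := by
        rw [← hper ((t + 2 * Real.pi * ((0 : ℕ) : ℝ)) / (p : ℝ))]
        congr 1
        field_simp
        simp
      rw [← Finset.Ico_add_one_right_eq_Icc, Finset.sum_Ico_eq_sub _ (by omega),
        Finset.sum_range_succ, Finset.sum_range_one, hends, add_sub_cancel_right]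
    rw [hshift]
    simp only [hterm]
    rw [← Finset.mul_sum]
    ring
  simp only [hint]
  rw [hfold]
  field_simp
end

section
/- For all integers p ≥ 1 and m ≥ 1 and every R ≥ 0, one has (1/π) ∫_0^π cos(mt) · (1/p) Σ_{s=1}^p exp( R cos((t+(2s+1)π)/p) ) dt = (−1)^m I_{pm}(R). -/
open Complex in
/-- Orthogonality of the complex exponentials over a period. -/
theorem integral_exp_int_mul_I (k : ℤ) :
    ∫ u in (0 : ℝ)..2 * Real.pi, cexp (k * u * I) = if k = 0 then 2 * (Real.pi : ℂ) else 0 := by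
  split_ifs with hk
  · simp [hk]
  · have hc : (k : ℂ) * I ≠ 0 := mul_ne_zero (by exact_mod_cast hk) I_ne_zero
    have h := integral_exp_mul_complex (a := 0) (b := 2 * Real.pi) hc
    have h1 : cexp (k * I * ((2 * Real.pi : ℝ) : ℂ)) = 1 := by
      rw [← Complex.exp_int_mul_two_pi_mul_I k]
      congr 1
      push_cast
      ring
    rw [h1] at h
    simp only [ofReal_zero, mul_zero, Complex.exp_zero, sub_self, zero_div] at h
    rw [← h]
    congr 1
    ext u
    congr 1
    ring

open Complex in
/-- The double power series of `exp (R cos u)` in `exp (± i u)`. -/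
theorem hasSum_exp_mul_cos_s6 (R u : ℝ) :
    HasSum (fun x : ℕ × ℕ => (((R / 2) ^ (x.1 + x.2) / (x.1.factorial * x.2.factorial) : ℝ) : ℂ) *
      cexp (((x.1 : ℤ) - (x.2 : ℤ) : ℤ) * u * I)) (Real.exp (R * Real.cos u) : ℂ) := by
  have key (z : ℂ) : HasSum (fun n : ℕ => z ^ n / (n.factorial : ℂ)) (cexp z) := by
    rw [Complex.exp_eq_exp_ℂ]
    exact NormedSpace.expSeries_div_hasSum_exp z
  have keyn (z : ℂ) : Summable (fun n : ℕ => ‖z ^ n / (n.factorial : ℂ)‖) :=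
    NormedSpace.norm_expSeries_div_summable z
  set a : ℂ := (R / 2 : ℝ) * cexp (u * I)
  set b : ℂ := (R / 2 : ℝ) * cexp (-(u * I))
  have hab := summable_mul_of_summable_norm (f := fun n : ℕ => a ^ n / (n.factorial : ℂ))
    (g := fun n : ℕ => b ^ n / (n.factorial : ℂ)) (keyn a) (keyn b)
  have h := (key a).mul (key b) hab
  have hterm (x : ℕ × ℕ) : (((R / 2) ^ (x.1 + x.2) / (x.1.factorial * x.2.factorial) : ℝ) : ℂ) *
      cexp (((x.1 : ℤ) - (x.2 : ℤ) : ℤ) * u * I) =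
      a ^ x.1 / (x.1.factorial : ℂ) * (b ^ x.2 / (x.2.factorial : ℂ)) := by
    have hexp : cexp (((x.1 : ℤ) - (x.2 : ℤ) : ℤ) * u * I) =
        cexp (u * I) ^ x.1 * cexp (-(u * I)) ^ x.2 := by
      rw [← Complex.exp_nat_mul, ← Complex.exp_nat_mul, ← Complex.exp_add]
      congr 1
      push_cast
      ring
    rw [hexp]
    simp only [a, b, mul_pow, pow_add]
    push_cast
    ring
  have hval : (Real.exp (R * Real.cos u) : ℂ) = cexp a * cexp b := by
    rw [← Complex.exp_add, ofReal_exp]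
    congr 1
    push_cast
    rw [Complex.cos]
    simp only [a, b]
    push_cast
    rw [neg_mul]
    ring
  rw [hval]
  simp only [hterm]
  exact h

open Complex in
theorem integral_cexp_mul_exp_mul_cos (n : ℕ) (R : ℝ) :
    ∫ u in (0 : ℝ)..2 * Real.pi, cexp (n * u * I) * (Real.exp (R * Real.cos u) : ℂ) =
      ((2 * Real.pi * besselIN n R : ℝ) : ℂ) := by
  set c : ℕ × ℕ → ℝ := fun x => (R / 2) ^ (x.1 + x.2) / (x.1.factorial * x.2.factorial) with hc
  set f : ℕ × ℕ → C(ℝ, ℂ) := fun x =>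
    ⟨fun u => cexp (n * u * I) * ((c x : ℂ) * cexp (((x.1 : ℤ) - (x.2 : ℤ) : ℤ) * u * I)),
      by fun_prop⟩ with hf
  have hcs : Summable fun x => ‖c x‖ := by
    have h := (Real.summable_pow_div_factorial (R / 2)).norm
    have hprod := (summable_mul_of_summable_norm
      (f := fun n : ℕ => (R / 2) ^ n / (n.factorial : ℝ))
      (g := fun n : ℕ => (R / 2) ^ n / (n.factorial : ℝ)) h h).norm
    refine hprod.congr fun x => ?_
    congr 1
    simp only [hc, pow_add]
    ring
  have hnorm (k : ℤ) (u : ℝ) : ‖cexp (k * u * I)‖ = 1 := by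
    have := Complex.norm_exp_ofReal_mul_I (k * u)
    push_cast at this
    exact this
  have hfn (x : ℕ × ℕ) (u : ℝ) : ‖f x u‖ = ‖c x‖ := by
    have h1 := hnorm n u
    have h2 := hnorm ((x.1 : ℤ) - (x.2 : ℤ)) u
    rw [Int.cast_natCast] at h1
    simp only [hf, ContinuousMap.coe_mk, norm_mul, h1, h2, one_mul, mul_one, Complex.norm_real]
  have hsum := intervalIntegral.hasSum_intervalIntegral_of_summable_norm
    (a := (0 : ℝ)) (b := 2 * Real.pi) (f := f) <| by
      refine hcs.of_nonneg_of_le (fun _ => norm_nonneg _) fun x => ?_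
      rw [ContinuousMap.norm_le _ (norm_nonneg _)]
      intro u
      exact (hfn x u).le
  have hts (u : ℝ) : ∑' x, f x u = cexp (n * u * I) * (Real.exp (R * Real.cos u) : ℂ) :=
    ((hasSum_exp_mul_cos_s6 R u).mul_left _).tsum_eq
  simp only [hts] at hsum
  have hterm_integral (x : ℕ × ℕ) : ∫ u in (0 : ℝ)..2 * Real.pi, f x u =
      c x * if x.1 + n = x.2 then 2 * (Real.pi : ℂ) else 0 := by
    have h := integral_exp_int_mul_I ((n : ℤ) + x.1 - x.2)
    have hiff : ((n : ℤ) + x.1 - x.2 = 0) ↔ (x.1 + n = x.2) := by omega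
    simp only [hiff] at h
    rw [← h, ← intervalIntegral.integral_const_mul]
    congr 1
    ext u
    simp only [hf, ContinuousMap.coe_mk]
    rw [mul_left_comm, ← Complex.exp_add]
    congr 2
    push_cast
    ring
  have hinj : Function.Injective fun k : ℕ => (k, k + n) := fun a b h => (Prod.mk.inj h).1
  simp only [hterm_integral] at hsum
  rw [← hinj.hasSum_iff] at hsum
  · have hB : besselIN n R = ∑' k : ℕ, c (k, k + n) :=
      tsum_congr fun k => by
        simp only [hc]
        congr 2
        ring
    rw [← hsum.tsum_eq, hB]
    simp only [Function.comp_def, if_true]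
    rw [tsum_mul_right, ← Complex.ofReal_tsum]
    simp only [Complex.ofReal_mul, Complex.ofReal_ofNat]
    ring
  · rintro ⟨a, b⟩ hx
    have : a + n ≠ b := fun h => hx ⟨a, by simp [h]⟩
    simp [this]

open Complex in
/-- Integral representation of the modified Bessel function. -/
theorem integral_cos_mul_exp_mul_cos (n : ℕ) (R : ℝ) :
    ∫ u in (0 : ℝ)..2 * Real.pi, Real.cos (n * u) * Real.exp (R * Real.cos u) =
      2 * Real.pi * besselIN n R := by
  have h := congrArg Complex.re (integral_cexp_mul_exp_mul_cos n R)
  rw [Complex.ofReal_re] at h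
  rw [← h, ← Complex.reCLM_apply, ← ContinuousLinearMap.intervalIntegral_comp_comm]
  · congr 1
    ext u
    rw [Complex.reCLM_apply, Complex.re_mul_ofReal]
    congr 1
    rw [← Complex.exp_ofReal_mul_I_re]
    push_cast
    rfl
  · exact Continuous.intervalIntegrable (by fun_prop) _ _

/-- Averaging an even periodic function over shifted and dilated half-periods recovers its
integral over a period. -/
theorem integral_sum_comp_add_div {g : ℝ → ℝ} (hg : Continuous g) (heven : ∀ u, g (-u) = g u)
    (hper : Function.Periodic g (2 * Real.pi)) {p : ℕ} (hp : p ≠ 0) :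
    2 * ∫ t in (0 : ℝ)..Real.pi,
        ∑ s ∈ Finset.Icc 1 p, g ((t + (2 * (s : ℝ) + 1) * Real.pi) / p) =
      p * ∫ u in (0 : ℝ)..2 * Real.pi, g u := by
  have hp' : (p : ℝ) ≠ 0 := by exact_mod_cast hp
  have hrange (t : ℝ) : ∑ s ∈ Finset.Icc 1 p, g ((t + (2 * (s : ℝ) + 1) * Real.pi) / p) =
      ∑ s ∈ Finset.range p, g ((t + (2 * (s : ℝ) + 1) * Real.pi) / p) := by
    set F : ℕ → ℝ := fun s => g ((t + (2 * (s : ℝ) + 1) * Real.pi) / p) with hF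
    have h0 : F p = F 0 := by
      simp only [hF]
      rw [← hper ((t + (2 * ((0 : ℕ) : ℝ) + 1) * Real.pi) / p)]
      congr 1
      field_simp
      push_cast
      ring
    have h1 : ∑ s ∈ Finset.Icc 1 p, F s = ∑ s ∈ Finset.range p, F (s + 1) := by
      rw [Finset.range_eq_Ico, Finset.sum_Ico_add', zero_add]
      rfl
    have h2 := Finset.sum_range_succ F p
    rw [Finset.sum_range_succ'] at h2
    linarith
  simp only [hrange]
  set h : ℝ → ℝ := fun t => ∑ s ∈ Finset.range p, g ((t + (2 * (s : ℝ) + 1) * Real.pi) / p)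
    with hh
  have hcont : Continuous h := by fun_prop
  have hheven (t : ℝ) : h (-t) = h t := by
    simp only [hh]
    rw [← Finset.sum_range_reflect]
    refine Finset.sum_congr rfl fun s hs => ?_
    have hs' : s + 1 ≤ p := Finset.mem_range.mp hs
    refine (heven _).symm.trans ((hper _).symm.trans (congrArg g ?_))
    rw [Nat.sub_sub, Nat.cast_sub (by omega)]
    field_simp
    push_cast
    ring
  have hsplit : ∫ t in (-Real.pi)..Real.pi, h t = 2 * ∫ t in (0 : ℝ)..Real.pi, h t := by
    rw [← intervalIntegral.integral_add_adjacent_intervals (b := 0)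
      (hcont.intervalIntegrable _ _) (hcont.intervalIntegrable _ _)]
    have := intervalIntegral.integral_comp_neg (a := 0) (b := Real.pi) h
    simp only [hheven, neg_zero] at this
    rw [← this]
    ring
  rw [← hsplit]
  simp only [hh]
  rw [intervalIntegral.integral_finsetSum
    fun s _ => Continuous.intervalIntegrable (by fun_prop) _ _]
  have hsub (s : ℕ) :
      ∫ t in (-Real.pi)..Real.pi, g ((t + (2 * (s : ℝ) + 1) * Real.pi) / p) =
      p * ∫ u in (2 * (s : ℝ) * Real.pi / p)..(2 * ((s + 1 : ℕ) : ℝ) * Real.pi / p), g u := by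
    have := intervalIntegral.integral_comp_div_add (a := -Real.pi) (b := Real.pi) g hp'
      ((2 * (s : ℝ) + 1) * Real.pi / p)
    simp only [← add_div, smul_eq_mul] at this
    rw [this]
    congr 2 <;> push_cast <;> ring
  simp only [hsub]
  rw [← Finset.mul_sum, intervalIntegral.sum_integral_adjacent_intervals
    (a := fun s : ℕ => 2 * (s : ℝ) * Real.pi / p) fun s _ => hg.intervalIntegrable _ _]
  congr 2
  · simp
  · field_simp

theorem stmt6 (p m : ℕ) (hp : 1 ≤ p) (hm : 1 ≤ m) (R : ℝ) (hR : 0 ≤ R) :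
    (1 / Real.pi) * ∫ t in (0 : ℝ)..Real.pi,
        Real.cos ((m : ℝ) * t) * ((1 / (p : ℝ)) * ∑ s ∈ Finset.Icc 1 p,
          Real.exp (R * Real.cos ((t + (2 * (s : ℝ) + 1) * Real.pi) / (p : ℝ)))) =
      (-1 : ℝ) ^ m * besselIN (p * m) R := by
  have hp0 : p ≠ 0 := by omega
  have hp' : (p : ℝ) ≠ 0 := by exact_mod_cast hp0
  set g : ℝ → ℝ := fun u => Real.cos ((p * m : ℕ) * u) * Real.exp (R * Real.cos u) with hg
  have hgper : Function.Periodic g (2 * Real.pi) := fun u => by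
    simp only [hg, mul_add, Real.cos_add_two_pi, Real.cos_add_nat_mul_two_pi]
  have hmain := integral_sum_comp_add_div (g := g) (by fun_prop)
    (fun u => by simp only [hg, mul_neg, Real.cos_neg]) hgper hp0
  rw [integral_cos_mul_exp_mul_cos] at hmain
  have hcos (t : ℝ) (s : ℕ) :
      Real.cos ((p * m : ℕ) * ((t + (2 * (s : ℝ) + 1) * Real.pi) / p)) =
        (-1) ^ m * Real.cos (m * t) := by
    have harg : (p * m : ℕ) * ((t + (2 * (s : ℝ) + 1) * Real.pi) / p) =
        m * t + m * Real.pi + (m * s : ℕ) * (2 * Real.pi) := by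
      push_cast
      field_simp
      ring
    rw [harg, Real.cos_add_nat_mul_two_pi, Real.cos_add_nat_mul_pi]
  have hintegrand_eq (t : ℝ) : Real.cos ((m : ℝ) * t) * ((1 / (p : ℝ)) * ∑ s ∈ Finset.Icc 1 p,
      Real.exp (R * Real.cos ((t + (2 * (s : ℝ) + 1) * Real.pi) / (p : ℝ)))) =
      ((-1) ^ m / p) * ∑ s ∈ Finset.Icc 1 p, g ((t + (2 * (s : ℝ) + 1) * Real.pi) / p) := by
    simp only [hg, hcos]
    rw [← Finset.mul_sum]
    have h1 : ((-1 : ℝ) ^ m) * (-1) ^ m = 1 := by rw [← mul_pow]; simp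
    linear_combination (-(Real.cos (m * t) / p * ∑ s ∈ Finset.Icc 1 p,
      Real.exp (R * Real.cos ((t + (2 * (s : ℝ) + 1) * Real.pi) / (p : ℝ))))) * h1
  simp only [hintegrand_eq]
  rw [intervalIntegral.integral_const_mul]
  have hpi := Real.pi_ne_zero
  set J := ∫ t in (0 : ℝ)..Real.pi,
    ∑ s ∈ Finset.Icc 1 p, g ((t + (2 * (s : ℝ) + 1) * Real.pi) / p)
  field_simp
  linear_combination (1 / 2) * hmain
end

section
/- Let ν ≥ 1 be an integer, R > 0, and ζ ∈ [0,π]. Then (4/R²)^ν Σ_{j=0}^∞ (2j+ν) I_{2(2j+ν)}(R) C_{2j}^ν(cos ζ) = (1/(4 Γ(2ν))) · [ i_{ν−1/2}( R cos(ζ/2) ) + i_{ν−1/2}( R sin(ζ/2) ) ]. -/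
/-- Pochhammer symbol `(a)_n = a (a+1) ⋯ (a+n-1)`. -/
noncomputable def pochh (a : ℝ) (n : ℕ) : ℝ := ∏ i ∈ Finset.range n, (a + i)

/-- Normalized modified Bessel function `i_α`. -/
noncomputable def besselNormI (α x : ℝ) : ℝ :=
  ∑' m : ℕ, (x / 2) ^ (2 * m) / (pochh (α + 1) m * Nat.factorial m)

open Finset

/-- The `k`-th summand of `gegenbauerC (μ + 1) n x`, extended by zero to all `k`. -/
noncomputable def gegenbauerTerm (μ n k : ℕ) (x : ℝ) : ℝ :=
  if 2 * k ≤ n then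
    (-1 : ℝ) ^ k * (μ + n - k).factorial / (μ.factorial * k.factorial * (n - 2 * k).factorial) *
      (2 * x) ^ (n - 2 * k)
  else 0

lemma gegenbauerC_eq_sum_gegenbauerTerm (μ n N : ℕ) (hN : n / 2 + 1 ≤ N) (x : ℝ) :
    gegenbauerC ((μ + 1 : ℕ) : ℝ) n x = ∑ k ∈ range N, gegenbauerTerm μ n k x := by
  rw [gegenbauerC, ← sum_subset (range_subset_range.2 hN)]
  · refine sum_congr rfl fun k hk => ?_
    have hk' : 2 * k ≤ n := by have := mem_range.1 hk; omega
    have h1 : ((μ + 1 : ℕ) : ℝ) + n - k = ((μ + n - k : ℕ) : ℝ) + 1 := by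
      rw [Nat.cast_sub (by omega)]
      push_cast
      ring
    rw [gegenbauerTerm, if_pos hk', h1, Real.Gamma_nat_eq_factorial, Nat.cast_succ,
      Real.Gamma_nat_eq_factorial]
  · intro k _ hk
    rw [mem_range] at hk
    exact if_neg (by omega)

lemma gegenbauerTerm_zero_rec (μ n : ℕ) (x : ℝ) :
    (n + 2 : ℝ) * gegenbauerTerm μ (n + 2) 0 x =
      2 * (n + μ + 2) * x * gegenbauerTerm μ (n + 1) 0 x := by
  simp only [gegenbauerTerm, mul_zero, Nat.zero_le, if_true, Nat.sub_zero, ← add_assoc,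
    Nat.factorial_succ, Nat.factorial_zero]
  have h1 := Nat.factorial_ne_zero μ
  have h2 := Nat.factorial_ne_zero n
  push_cast
  field_simp
  ring

lemma gegenbauerTerm_succ_rec (μ n k : ℕ) (x : ℝ) :
    (n + 2 : ℝ) * gegenbauerTerm μ (n + 2) (k + 1) x =
      2 * (n + μ + 2) * x * gegenbauerTerm μ (n + 1) (k + 1) x -
        (n + 2 * μ + 2) * gegenbauerTerm μ n k x := by
  have h1 := Nat.factorial_ne_zero μ
  have h2 := Nat.factorial_ne_zero k
  rcases lt_or_ge n (2 * k) with h | h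
  · simp only [gegenbauerTerm]
    rw [if_neg (by omega), if_neg (by omega), if_neg (by omega)]
    ring
  obtain ⟨l, rfl⟩ := Nat.exists_eq_add_of_le h
  simp only [gegenbauerTerm]
  rw [if_pos (by omega : 2 * (k + 1) ≤ 2 * k + l + 2), if_pos h]
  have e1 : μ + (2 * k + l + 2) - (k + 1) = μ + k + l + 1 := by omega
  have e2 : 2 * k + l + 2 - 2 * (k + 1) = l := by omega
  have e3 : μ + (2 * k + l) - k = μ + k + l := by omega
  have e4 : 2 * k + l - 2 * k = l := by omega
  rw [e1, e2, e3, e4]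
  rcases l with _ | l
  · rw [if_neg (by omega)]
    simp only [add_zero, Nat.factorial_succ, Nat.factorial_zero, pow_succ, pow_zero]
    push_cast
    field_simp
    ring
  · rw [if_pos (by omega)]
    have e5 : μ + (2 * k + (l + 1) + 1) - (k + 1) = μ + k + l + 1 := by omega
    have e6 : 2 * k + (l + 1) + 1 - 2 * (k + 1) = l := by omega
    have h3 := Nat.factorial_ne_zero l
    rw [e5, e6]
    simp only [← add_assoc, Nat.factorial_succ, pow_succ]
    push_cast
    field_simp
    ring

lemma gegenbauerC_zero_s11 (μ : ℕ) (x : ℝ) : gegenbauerC ((μ + 1 : ℕ) : ℝ) 0 x = 1 := by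
  rw [gegenbauerC_eq_sum_gegenbauerTerm μ 0 1 (by norm_num)]
  have := Nat.factorial_ne_zero μ
  simp [gegenbauerTerm, this]

lemma gegenbauerC_one (μ : ℕ) (x : ℝ) :
    gegenbauerC ((μ + 1 : ℕ) : ℝ) 1 x = 2 * (μ + 1) * x := by
  rw [gegenbauerC_eq_sum_gegenbauerTerm μ 1 1 (by norm_num)]
  have := Nat.factorial_ne_zero μ
  simp [gegenbauerTerm, Nat.factorial_succ]
  field_simp

/-- The three-term recurrence of the Gegenbauer polynomials. -/
lemma gegenbauerC_rec (μ n : ℕ) (x : ℝ) :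
    (n + 2 : ℝ) * gegenbauerC ((μ + 1 : ℕ) : ℝ) (n + 2) x =
      2 * (n + μ + 2) * x * gegenbauerC ((μ + 1 : ℕ) : ℝ) (n + 1) x -
        (n + 2 * μ + 2) * gegenbauerC ((μ + 1 : ℕ) : ℝ) n x := by
  rw [gegenbauerC_eq_sum_gegenbauerTerm μ (n + 2) (n + 2) (by omega),
    gegenbauerC_eq_sum_gegenbauerTerm μ (n + 1) (n + 2) (by omega),
    gegenbauerC_eq_sum_gegenbauerTerm μ n (n + 1) (by omega), sum_range_succ' _ (n + 1),
    sum_range_succ' _ (n + 1), mul_add, mul_add, gegenbauerTerm_zero_rec, mul_sum, mul_sum, mul_sum,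
    sum_congr rfl fun k _ => gegenbauerTerm_succ_rec μ n k x, sum_sub_distrib]
  ring

lemma gegenbauerC_neg (ν : ℝ) (n : ℕ) (x : ℝ) :
    gegenbauerC ν n (-x) = (-1) ^ n * gegenbauerC ν n x := by
  rw [gegenbauerC, gegenbauerC, mul_sum]
  refine sum_congr rfl fun k hk => ?_
  have hk' : 2 * k ≤ n := by have := mem_range.1 hk; omega
  obtain ⟨l, rfl⟩ := Nat.exists_eq_add_of_le hk'
  rw [mul_neg, neg_pow (2 * x), Nat.add_sub_cancel_left, pow_add, pow_mul, neg_one_sq, one_pow]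
  ring

lemma abs_gegenbauerC_le (μ n : ℕ) {x : ℝ} (hx : |x| ≤ 1) :
    |gegenbauerC ((μ + 1 : ℕ) : ℝ) n x| ≤ (2 * μ + 3 : ℝ) ^ n := by
  induction n using Nat.twoStepInduction with
  | zero => rw [gegenbauerC_zero_s11, abs_one, pow_zero]
  | one =>
    rw [gegenbauerC_one, abs_mul, abs_of_nonneg (by positivity), pow_one]
    nlinarith [Nat.cast_nonneg (α := ℝ) μ]
  | more n h0 h1 =>
    have hpos : (0 : ℝ) < n + 2 := by positivity
    refine le_of_mul_le_mul_left ?_ hpos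
    set K : ℝ := 2 * μ + 3 with hK
    have hμ : (0 : ℝ) ≤ μ := Nat.cast_nonneg μ
    have hn : (0 : ℝ) ≤ n := Nat.cast_nonneg n
    have hKn : 0 ≤ K ^ n := by positivity
    calc (n + 2 : ℝ) * |gegenbauerC ((μ + 1 : ℕ) : ℝ) (n + 2) x|
        = |2 * (n + μ + 2) * x * gegenbauerC ((μ + 1 : ℕ) : ℝ) (n + 1) x -
            (n + 2 * μ + 2) * gegenbauerC ((μ + 1 : ℕ) : ℝ) n x| := by
          rw [← gegenbauerC_rec, abs_mul, abs_of_pos hpos]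
      _ ≤ 2 * (n + μ + 2) * (|x| * |gegenbauerC ((μ + 1 : ℕ) : ℝ) (n + 1) x|) +
            (n + 2 * μ + 2) * |gegenbauerC ((μ + 1 : ℕ) : ℝ) n x| := by
          refine (abs_sub _ _).trans_eq ?_
          rw [abs_mul, abs_mul, abs_mul (n + 2 * μ + 2 : ℝ),
            abs_of_nonneg (a := 2 * _) (by positivity),
            abs_of_nonneg (a := (n + 2 * μ + 2 : ℝ)) (by positivity), mul_assoc]
      _ ≤ 2 * (n + μ + 2) * (1 * K ^ (n + 1)) + (n + 2 * μ + 2) * K ^ n := by gcongr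
      _ = (2 * (n + μ + 2) * K + (n + 2 * μ + 2)) * K ^ n := by ring
      _ ≤ ((n + 2) * K ^ 2) * K ^ n := by
          refine mul_le_mul_of_nonneg_right ?_ hKn
          rw [hK]
          nlinarith [mul_nonneg hn hμ, mul_nonneg hμ hμ, mul_nonneg (mul_nonneg hμ hμ) hn]
      _ = (n + 2) * K ^ (n + 2) := by ring

/-- Taylor coefficients `1 / ((M - n)! (M + n + 2 ν)!)` of the Bessel functions `I_{2 (n + ν)}`,
with `ν = μ + 1`. -/
noncomputable def besselCoeff (μ M n : ℕ) : ℝ :=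
  if n ≤ M then 1 / ((M - n).factorial * (M + n + 2 * μ + 2).factorial) else 0

lemma besselCoeff_add (μ m n : ℕ) : besselCoeff μ (n + m) n =
    1 / (m.factorial * (2 * n + m + 2 * μ + 2).factorial) := by
  rw [besselCoeff, if_pos (by omega), Nat.add_sub_cancel_left]
  congr 4
  omega

lemma besselCoeff_of_lt (μ : ℕ) {M n : ℕ} (h : M < n) : besselCoeff μ M n = 0 :=
  if_neg (by omega)

lemma besselCoeff_zero_rec (μ M : ℕ) :
    (M + 1 : ℝ) * (μ + 3 / 2 + M) * (besselCoeff μ (M + 1) 0 * (μ + 1)) =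
      (μ + 1) / 2 * besselCoeff μ M 0 + (2 * μ + 2) / 4 * besselCoeff μ M 1 := by
  rcases M with _ | M
  · have h := Nat.factorial_ne_zero (2 * μ)
    have e1 : 1 + 2 * μ + 2 = 2 * μ + 3 := by ring
    simp [besselCoeff, Nat.factorial_succ, e1]
    field_simp
    ring
  · have h := Nat.factorial_ne_zero (M + 2 * μ + 3)
    have h' := Nat.factorial_ne_zero M
    have e0 : M + 1 + 0 + 2 * μ + 2 = M + 2 * μ + 3 := by ring
    have e1 : M + 1 + 1 + 0 + 2 * μ + 2 = M + 2 * μ + 3 + 1 := by ring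
    simp only [besselCoeff, e0, e1, Nat.factorial_succ (M + 2 * μ + 3), Nat.le_add_left, if_true,
      Nat.sub_zero, Nat.add_sub_cancel, Nat.factorial_succ M,
      Nat.factorial_succ (M + 1)]
    push_cast
    field_simp
    ring

lemma besselCoeff_succ_rec (μ M n : ℕ) :
    (M + 1 : ℝ) * (μ + 3 / 2 + M) * (besselCoeff μ (M + 1) (n + 1) * (n + μ + 2)) =
      (n + μ + 2) / 2 * besselCoeff μ M (n + 1) + (n + 1) / 4 * besselCoeff μ M n +
        (n + 2 * μ + 3) / 4 * besselCoeff μ M (n + 2) := by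
  rcases lt_or_ge M n with hM | hM
  · simp [besselCoeff_of_lt μ hM, besselCoeff_of_lt μ (by omega : M + 1 < n + 1),
      besselCoeff_of_lt μ (by omega : M < n + 1), besselCoeff_of_lt μ (by omega : M < n + 2)]
  obtain ⟨m, rfl⟩ := Nat.exists_eq_add_of_le hM
  have hF := Nat.factorial_ne_zero (2 * n + m + 2 * μ + 2)
  have e1 : besselCoeff μ (n + m + 1) (n + 1) =
      1 / (m.factorial * (2 * n + m + 2 * μ + 4).factorial) := by
    rw [show n + m + 1 = n + 1 + m by ring, besselCoeff_add]
    congr 4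
    ring
  rw [e1, besselCoeff_add]
  rcases m with _ | _ | m
  · rw [besselCoeff_of_lt μ (by omega : n + 0 < n + 1),
      besselCoeff_of_lt μ (by omega : n + 0 < n + 2)]
    simp [Nat.factorial_succ]
    field_simp
    ring
  · rw [besselCoeff_of_lt μ (by omega : n + (0 + 1) < n + 2), zero_add, besselCoeff,
      if_pos le_rfl]
    have e2 : n + 1 + (n + 1) + 2 * μ + 2 = 2 * n + 1 + 2 * μ + 2 + 1 := by ring
    rw [e2]
    simp [Nat.factorial_succ _]
    field_simp
    ring
  · have hm := Nat.factorial_ne_zero m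
    have e2 : besselCoeff μ (n + (m + 1 + 1)) (n + 1) =
        1 / ((m + 1).factorial * (2 * n + (m + 1 + 1) + 2 * μ + 3).factorial) := by
      rw [show n + (m + 1 + 1) = n + 1 + (m + 1) by ring, besselCoeff_add]
      congr 4
      ring
    have e3 : besselCoeff μ (n + (m + 1 + 1)) (n + 2) =
        1 / (m.factorial * (2 * n + (m + 1 + 1) + 2 * μ + 4).factorial) := by
      rw [show n + (m + 1 + 1) = n + 2 + m by ring, besselCoeff_add]
      congr 4
      ring
    rw [e2, e3]
    simp only [Nat.factorial_succ _]
    push_cast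
    field_simp
    ring

lemma sum_gegenbauerC_telescope (μ M : ℕ) (x : ℝ) (n : ℕ) :
    ∑ i ∈ range (n + 1), ((M + 1 : ℝ) * (μ + 3 / 2 + M) * (besselCoeff μ (M + 1) i * (i + μ + 1)) -
        (1 + x) / 2 * (besselCoeff μ M i * (i + μ + 1))) * gegenbauerC ((μ + 1 : ℕ) : ℝ) i x =
      ((n + 2 * μ + 2) * besselCoeff μ M (n + 1) * gegenbauerC ((μ + 1 : ℕ) : ℝ) n x -
        (n + 1) * besselCoeff μ M n * gegenbauerC ((μ + 1 : ℕ) : ℝ) (n + 1) x) / 4 := by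
  induction n with
  | zero =>
    have h := besselCoeff_zero_rec μ M
    simp only [zero_add, sum_range_one, gegenbauerC_zero_s11, gegenbauerC_one, Nat.cast_zero]
    linear_combination h
  | succ n ih =>
    rw [sum_range_succ, ih]
    have h := besselCoeff_succ_rec μ M n
    have h2 := gegenbauerC_rec μ n x
    push_cast at h2 ⊢
    linear_combination gegenbauerC (μ + 1 : ℝ) (n + 1) x * h + besselCoeff μ M (n + 1) / 4 * h2

lemma sum_besselCoeff_mul_gegenbauerC (μ M : ℕ) (x : ℝ) :
    ∑ n ∈ range (M + 1), besselCoeff μ M n * (n + μ + 1) * gegenbauerC ((μ + 1 : ℕ) : ℝ) n x =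
      1 / (2 * (2 * μ + 1).factorial) *
        (((1 + x) / 2) ^ M / (pochh (μ + 3 / 2) M * M.factorial)) := by
  induction M with
  | zero =>
    rw [zero_add, sum_range_one, gegenbauerC_zero_s11]
    simp [besselCoeff, pochh, Nat.factorial_succ]
    field_simp
    ring
  | succ M ih =>
    have h := sum_gegenbauerC_telescope μ M x (M + 1)
    rw [besselCoeff_of_lt μ (by omega : M < M + 1), besselCoeff_of_lt μ (by omega : M < M + 1 + 1)]
      at h
    simp only [sub_mul, sum_sub_distrib, mul_assoc, ← mul_sum] at h ih ⊢
    rw [sum_range_succ (fun i => besselCoeff μ M i * _) (M + 1),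
      besselCoeff_of_lt μ (by omega : M < M + 1), zero_mul, add_zero, ih] at h
    have hp : (0 : ℝ) < pochh (μ + 3 / 2) M := prod_pos fun i _ => by positivity
    have hs : pochh (μ + 3 / 2) (M + 1) = pochh (μ + 3 / 2) M * (μ + 3 / 2 + M) :=
      prod_range_succ _ _
    have hM := Nat.factorial_ne_zero M
    have hμ := Nat.factorial_ne_zero (2 * μ + 1)
    have hc : (μ + 3 / 2 + M : ℝ) ≠ 0 := by positivity
    rw [hs, Nat.factorial_succ M]
    refine mul_left_cancel₀ (mul_ne_zero (by positivity : (M + 1 : ℝ) ≠ 0) hc) ?_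
    trans (1 + x) / 2 * (1 / (2 * ((2 * μ + 1).factorial : ℝ)) *
      (((1 + x) / 2) ^ M / (pochh (μ + 3 / 2) M * M.factorial)))
    · push_cast at h ⊢
      linear_combination h
    · push_cast
      field_simp
      ring

lemma besselI_eq_tsum_besselCoeff (μ n : ℕ) (R : ℝ) :
    besselI (2 * ((n : ℝ) + (μ + 1 : ℕ))) R =
      (R / 2) ^ (2 * (μ + 1)) * ∑' m : ℕ, besselCoeff μ (n + m) n * ((R / 2) ^ 2) ^ (n + m) := by
  rw [besselI, ← tsum_mul_left]
  refine tsum_congr fun m => ?_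
  have e1 : 2 * (m : ℝ) + 2 * ((n : ℝ) + (μ + 1 : ℕ)) = (2 * m + 2 * (n + (μ + 1)) : ℕ) := by
    push_cast
    ring
  have e2 : (m : ℝ) + 2 * ((n : ℝ) + (μ + 1 : ℕ)) + 1 = (2 * n + m + 2 * μ + 2 : ℕ) + 1 := by
    push_cast
    ring
  rw [e1, e2, Real.rpow_natCast, Real.Gamma_nat_eq_factorial, besselCoeff_add, ← pow_mul,
    one_div_mul_eq_div, ← mul_div_assoc,
    ← pow_add]
  congr 1
  ring

lemma summable_besselCoeff_mul_gegenbauerC (μ : ℕ) {u x : ℝ} (hu : 0 ≤ u) (hx : |x| ≤ 1) :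
    Summable fun p : ℕ × ℕ => besselCoeff μ (p.1 + p.2) p.1 * (p.1 + μ + 1) *
      gegenbauerC ((μ + 1 : ℕ) : ℝ) p.1 x * u ^ (p.1 + p.2) := by
  have hs := ((Real.summable_pow_div_factorial (2 * (2 * μ + 3) * u)).mul_of_nonneg
    (Real.summable_pow_div_factorial u) (fun n => by simp only [Pi.zero_apply]; positivity)
    (fun n => by simp only [Pi.zero_apply]; positivity)).mul_left (μ + 1 : ℝ)
  refine Summable.of_norm_bounded hs fun ⟨n, m⟩ => ?_
  have hn : (n + 1 : ℝ) ≤ 2 ^ n := by exact_mod_cast Nat.lt_two_pow_self (n := n)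
  have hf : (n.factorial : ℝ) ≤ (2 * n + m + 2 * μ + 2).factorial := by
    exact_mod_cast Nat.factorial_le (by omega)
  have hc : (n + μ + 1 : ℝ) ≤ (μ + 1) * 2 ^ n := by
    have hμ : (0 : ℝ) ≤ μ := Nat.cast_nonneg μ
    have hn' : (0 : ℝ) ≤ n := Nat.cast_nonneg n
    nlinarith [mul_le_mul_of_nonneg_left hn (by positivity : (0 : ℝ) ≤ μ + 1), mul_nonneg hμ hn']
  have hfn := Nat.factorial_pos n
  simp only [besselCoeff_add, Real.norm_eq_abs, abs_mul]
  rw [abs_of_nonneg (a := 1 / _) (by positivity),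
    abs_of_nonneg (a := (n + μ + 1 : ℝ)) (by positivity),
    abs_of_nonneg (a := u ^ _) (by positivity)]
  calc 1 / ((m.factorial : ℝ) * (2 * n + m + 2 * μ + 2).factorial) * (n + μ + 1) *
        |gegenbauerC ((μ + 1 : ℕ) : ℝ) n x| * u ^ (n + m)
      ≤ 1 / ((m.factorial : ℝ) * n.factorial) * ((μ + 1) * 2 ^ n) * (2 * μ + 3) ^ n *
          u ^ (n + m) := by
        gcongr
        exact abs_gegenbauerC_le μ n hx
    _ = (μ + 1) * ((2 * (2 * μ + 3) * u) ^ n / n.factorial * (u ^ m / m.factorial)) := by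
        rw [mul_pow, mul_pow, pow_add]
        field_simp

lemma Summable.hasSum_sum_range_succ {f : ℕ × ℕ → ℝ} (hf : Summable f) :
    HasSum (fun M => ∑ n ∈ range (M + 1), f (n, M - n)) (∑' p, f p) := by
  have h := ((HasAntidiagonal.sigmaAntidiagonalEquivProd :
    (Σ M : ℕ, antidiagonal M) ≃ ℕ × ℕ).hasSum_iff.2 hf.hasSum).sigma
    fun M => hasSum_fintype _
  refine h.congr_fun fun M => ?_
  rw [← Nat.sum_antidiagonal_eq_sum_range_succ_mk, ← sum_coe_sort]
  rfl

/-- The expansion of a normalized Bessel function in Gegenbauer polynomials. -/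
lemma hasSum_besselI_mul_gegenbauerC (μ : ℕ) (R : ℝ) {x y : ℝ} (hx : |x| ≤ 1)
    (hy : y ^ 2 = (1 + x) / 2) :
    HasSum (fun n : ℕ => ((n : ℝ) + (μ + 1 : ℕ)) * besselI (2 * ((n : ℝ) + (μ + 1 : ℕ))) R *
        gegenbauerC ((μ + 1 : ℕ) : ℝ) n x)
      ((R / 2) ^ (2 * (μ + 1)) * (1 / (2 * (2 * μ + 1).factorial) *
        besselNormI ((μ + 1 : ℕ) - 1 / 2) (R * y))) := by
  have hf := summable_besselCoeff_mul_gegenbauerC μ (sq_nonneg (R / 2)) hx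
  have h1 := (hf.hasSum.prod_fiberwise fun n => (hf.prod_factor n).hasSum).mul_left
    ((R / 2) ^ (2 * (μ + 1)))
  have h2 : ∑' p : ℕ × ℕ, besselCoeff μ (p.1 + p.2) p.1 * (p.1 + μ + 1) *
      gegenbauerC ((μ + 1 : ℕ) : ℝ) p.1 x * ((R / 2) ^ 2) ^ (p.1 + p.2) =
      1 / (2 * (2 * μ + 1).factorial) * besselNormI ((μ + 1 : ℕ) - 1 / 2) (R * y) := by
    rw [← hf.hasSum_sum_range_succ.tsum_eq, besselNormI, ← tsum_mul_left]
    refine tsum_congr fun M => ?_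
    have hν : ((μ + 1 : ℕ) : ℝ) - 1 / 2 + 1 = μ + 3 / 2 := by
      push_cast
      ring
    have hu : (R * y / 2) ^ (2 * M) = ((R / 2) ^ 2) ^ M * ((1 + x) / 2) ^ M := by
      rw [← hy, pow_mul, ← mul_pow]
      ring
    trans ((R / 2) ^ 2) ^ M * ∑ n ∈ range (M + 1), besselCoeff μ M n * (n + μ + 1) *
      gegenbauerC ((μ + 1 : ℕ) : ℝ) n x
    · rw [mul_sum]
      refine sum_congr rfl fun n hn => ?_
      rw [Nat.add_sub_cancel' (mem_range_succ_iff.1 hn), mul_comm]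
    · rw [sum_besselCoeff_mul_gegenbauerC, hν, hu]
      ring
  rw [h2] at h1
  refine h1.congr_fun fun n => ?_
  rw [besselI_eq_tsum_besselCoeff, mul_left_comm, mul_assoc, ← tsum_mul_left, ← tsum_mul_right]
  congr 1
  refine tsum_congr fun m => ?_
  push_cast
  ring

theorem stmt11 (ν : ℕ) (hν : 1 ≤ ν) (R : ℝ) (hR : 0 < R)
    (ζ : ℝ) (hζ : ζ ∈ Set.Icc 0 Real.pi) :
    (4 / R ^ 2) ^ ν *
      ∑' j : ℕ, (2 * (j : ℝ) + (ν : ℝ)) *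
        besselI (2 * (2 * (j : ℝ) + (ν : ℝ))) R *
        gegenbauerC (ν : ℝ) (2 * j) (Real.cos ζ) =
      (1 / (4 * Real.Gamma (2 * (ν : ℝ)))) *
        (besselNormI ((ν : ℝ) - 1 / 2) (R * Real.cos (ζ / 2)) +
         besselNormI ((ν : ℝ) - 1 / 2) (R * Real.sin (ζ / 2))) := by
  obtain ⟨μ, rfl⟩ := Nat.exists_eq_add_of_le' hν
  have hc : Real.cos (ζ / 2) ^ 2 = (1 + Real.cos ζ) / 2 := by
    rw [Real.cos_sq, mul_div_cancel₀ ζ two_ne_zero]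
    ring
  have hs : Real.sin (ζ / 2) ^ 2 = (1 + -Real.cos ζ) / 2 := by
    rw [Real.sin_sq, hc]
    ring
  have h := (hasSum_besselI_mul_gegenbauerC μ R (Real.abs_cos_le_one ζ) hc).add
    (hasSum_besselI_mul_gegenbauerC μ R ((abs_neg _).trans_le (Real.abs_cos_le_one ζ)) hs)
  rw [← (mul_right_injective₀ (two_ne_zero' ℕ)).hasSum_iff] at h
  · have h2 := h.mul_left (1 / 2)
    have hG : Real.Gamma (2 * ((μ + 1 : ℕ) : ℝ)) = (2 * μ + 1).factorial := by
      rw [← Real.Gamma_nat_eq_factorial]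
      congr 1
      push_cast
      ring
    have hR' : (4 / R ^ 2) ^ (μ + 1) * (R / 2) ^ (2 * (μ + 1)) = 1 := by
      rw [pow_mul, ← mul_pow]
      convert one_pow (μ + 1)
      field_simp
      norm_num
    rw [(h2.congr_fun fun j => ?_).tsum_eq, hG]
    swap
    · simp only [Function.comp_apply, gegenbauerC_neg, (even_two_mul j).neg_one_pow]
      push_cast
      ring
    linear_combination (1 / (4 * ((2 * μ + 1).factorial : ℝ)) *
        (besselNormI (((μ + 1 : ℕ) : ℝ) - 1 / 2) (R * Real.cos (ζ / 2)) +
         besselNormI (((μ + 1 : ℕ) : ℝ) - 1 / 2) (R * Real.sin (ζ / 2)))) * hR'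
  · intro n hn
    have hodd : Odd n := by
      rw [← Nat.not_even_iff_odd]
      rintro ⟨j, rfl⟩
      exact hn ⟨j, two_mul j⟩
    simp only [gegenbauerC_neg, hodd.neg_one_pow]
    ring
end
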